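/- arXiv:1909.13215 — 15 statements merged into one kernel-verified Lean document; each statement's English description precedes it below -/
import Mathlib

section
/- Let H be a real inner product space, let (A, b, c) be a Butcher tableau with s stages, let f : ℝ × H → H, let Δt ∈ ℝ and u₀ ∈ H. Suppose u₁, …, u_s ∈ H satisfy the stage equations u_i = u₀ + Δt Σ_{j=1}^s a_{ij} f(c_j Δt, u_j), and set u₊ = u₀ + Δt Σ_{i=1}^s b_i f(c_i Δt, u_i). Then ‖u₊‖² − ‖u₀‖² = 2 Δt Σ_{i=1}^s b_i ⟨u_i, f(c_i Δt, u_i)⟩ + Δt² Σ_{i,j=1}^s (b_i b_j − b_i a_{ij} − b_j a_{ji}) ⟨f(c_i Δt, u_i), f(c_j Δt, u_j)⟩. -/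
open scoped RealInnerProductSpace

/-- Energy evolution identity for a general Runge--Kutta step (equation (2.8) of the paper). -/
theorem energy_evolution_runge_kutta
    {H : Type*} [NormedAddCommGroup H] [InnerProductSpace ℝ H]
    (s : ℕ) (A : Fin s → Fin s → ℝ) (b c : Fin s → ℝ)
    (f : ℝ → H → H) (Δt : ℝ) (u₀ : H) (u : Fin s → H)
    (hstage : ∀ i, u i = u₀ + Δt • ∑ j, A i j • f (c j * Δt) (u j))
    (uplus : H)
    (hupdate : uplus = u₀ + Δt • ∑ i, b i • f (c i * Δt) (u i)) :
    ‖uplus‖ ^ 2 - ‖u₀‖ ^ 2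
      = 2 * Δt * ∑ i, b i * ⟪u i, f (c i * Δt) (u i)⟫
        + Δt ^ 2 * ∑ i, ∑ j, (b i * b j - b i * A i j - b j * A j i)
            * ⟪f (c i * Δt) (u i), f (c j * Δt) (u j)⟫ := by
  set k : Fin s → H := fun i => f (c i * Δt) (u i) with hk
  have hstage_inner (i : Fin s) :
      ⟪u i, k i⟫ = ⟪u₀, k i⟫ + Δt * ∑ j, A i j * ⟪k i, k j⟫ := by
    conv_lhs => rw [hstage i]
    simp only [inner_add_left, real_inner_smul_left, sum_inner, hk]
    exact congrArg _ (congrArg _ (Finset.sum_congr rfl fun j _ => by rw [real_inner_comm]))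
  have hupdate_norm : ‖uplus‖ ^ 2 = ‖u₀‖ ^ 2 + 2 * Δt * ∑ i, b i * ⟪u₀, k i⟫
      + Δt ^ 2 * ∑ i, ∑ j, b i * b j * ⟪k i, k j⟫ := by
    have hsq : ⟪∑ i, b i • k i, ∑ i, b i • k i⟫ = ∑ i, ∑ j, b i * b j * ⟪k i, k j⟫ := by
      simp only [inner_sum, sum_inner, real_inner_smul_left, real_inner_smul_right]
      exact Finset.sum_congr rfl fun i _ => Finset.sum_congr rfl fun j _ => by
        rw [real_inner_comm, mul_assoc]
    have hlin : ⟪u₀, ∑ i, b i • k i⟫ = ∑ i, b i * ⟪u₀, k i⟫ := by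
      simp only [inner_sum, real_inner_smul_right]
    rw [hupdate, norm_add_sq_real, real_inner_smul_right, hlin, norm_smul, mul_pow,
      Real.norm_eq_abs, sq_abs, ← real_inner_self_eq_norm_sq (∑ i, b i • k i), hsq]
    ring
  have hswap : ∑ i, ∑ j, b j * A j i * ⟪k i, k j⟫ = ∑ i, ∑ j, b i * A i j * ⟪k i, k j⟫ := by
    rw [Finset.sum_comm]
    simp only [real_inner_comm]
  have hwork : ∑ i, b i * ⟪u i, k i⟫
      = ∑ i, b i * ⟪u₀, k i⟫ + Δt * ∑ i, ∑ j, b i * A i j * ⟪k i, k j⟫ := by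
    simp only [hstage_inner, mul_add, Finset.sum_add_distrib, Finset.mul_sum]
    congr 1
    exact Finset.sum_congr rfl fun i _ => Finset.sum_congr rfl fun j _ => by ring
  change _ = 2 * Δt * ∑ i, b i * ⟪u i, k i⟫
    + Δt ^ 2 * ∑ i, ∑ j, (b i * b j - b i * A i j - b j * A j i) * ⟪k i, k j⟫
  simp only [sub_mul, Finset.sum_sub_distrib]
  rw [hupdate_norm, hwork, hswap]
  ring
end

section
/- Let (A, b, c) be an explicit Butcher tableau with s stages, and suppose there is an index k with b_k ≠ 0 and c_j ≠ c_k for all j ≠ k (a unique quadrature node). Then for every Δt > 0, every ε > 0, and every u₀ ∈ ℝ² with u₀ ≠ 0, there exists a map L : ℝ → M₂(ℝ) such that: L(t) is skew-symmetric for every t; ‖L(t)‖ ≤ ε for every t; ‖L(t) − L(s)‖ ≤ ε |t − s| for all t, s (in particular ⟨u, L(t)u⟩ = 0 for all u, so the linear problem u' = L(t)u is semibounded); and the Runge–Kutta step of size Δt from u₀ applied to u'(t) = L(t)u(t) satisfies ‖u₊‖ > ‖u₀‖. -/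
open scoped RealInnerProductSpace

/-- A linear isometry of the Euclidean plane that is skew-symmetric. -/
theorem exists_skew_linearIsometry :
    ∃ J : EuclideanSpace ℝ (Fin 2) →ₗᵢ[ℝ] EuclideanSpace ℝ (Fin 2),
      ∀ u v : EuclideanSpace ℝ (Fin 2), ⟪J u, v⟫ = -⟪u, J v⟫ := by
  have : Fact (Module.finrank ℝ (EuclideanSpace ℝ (Fin 2)) = 2) := ⟨by simp⟩
  let o := (EuclideanSpace.basisFun (Fin 2) ℝ).toBasis.orientation
  exact ⟨o.rightAngleRotation.toLinearIsometry, o.inner_rightAngleRotation_swap'⟩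

/-- A bounded Lipschitz tent that is positive at one point and vanishes at finitely many
other points. -/
theorem exists_tent {ι : Type*} [Finite ι] (p : ι → ℝ) (k : ι) (hp : ∀ j, j ≠ k → p j ≠ p k)
    {ε : ℝ} (hε : 0 < ε) :
    ∃ f : ℝ → ℝ, 0 < f (p k) ∧ (∀ j, j ≠ k → f (p j) = 0) ∧ (∀ t, |f t| ≤ ε) ∧
      ∀ t t', |f t - f t'| ≤ ε * |t - t'| := by
  obtain ⟨δ, ⟨hδ, hδ1⟩, hδp⟩ : ∃ δ : ℝ, (0 < δ ∧ δ ≤ 1) ∧ ∀ j, j ≠ k → δ ≤ |p j - p k| := by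
    have h0 : ∀ᶠ δ : ℝ in nhdsWithin 0 (Set.Ioi 0), 0 < δ ∧ δ ≤ 1 :=
      Ioc_mem_nhdsGT one_pos
    have h1 : ∀ᶠ δ : ℝ in nhdsWithin 0 (Set.Ioi 0), ∀ j, j ≠ k → δ ≤ |p j - p k| := by
      refine Filter.eventually_all.2 fun j => ?_
      by_cases hj : j = k
      · simp [hj]
      · filter_upwards [Ioc_mem_nhdsGT (abs_pos.2 (sub_ne_zero.2 (hp j hj)))] with δ h _
        exact h.2
    exact (h0.and h1).exists
  refine ⟨fun t => ε * max 0 (δ - |t - p k|), by simp [hδ, hε], fun j hj => ?_, fun t => ?_,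
    fun t t' => ?_⟩
  · simp [hδp j hj]
  · rw [abs_mul, abs_of_pos hε, abs_of_nonneg (le_max_left _ _)]
    exact mul_le_of_le_one_right hε.le
      (max_le zero_le_one (by linarith [abs_nonneg (t - p k)]))
  · rw [← mul_sub, abs_mul, abs_of_pos hε]
    refine mul_le_mul_of_nonneg_left ?_ hε.le
    calc |max 0 (δ - |t - p k|) - max 0 (δ - |t' - p k|)|
        ≤ |(δ - |t - p k|) - (δ - |t' - p k|)| := by
          simpa using abs_max_sub_max_le_max 0 (δ - |t - p k|) 0 (δ - |t' - p k|)
      _ = |(|t - p k|) - (|t' - p k|)| := by rw [sub_sub_sub_cancel_left, abs_sub_comm]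
      _ ≤ |(t - p k) - (t' - p k)| := abs_abs_sub_abs_le _ _
      _ = |t - t'| := by rw [sub_sub_sub_cancel_right]

/-- Theorem 3.5 (Lipschitz-impossible): an explicit Runge--Kutta method with a unique
quadrature node cannot be energy stable for semibounded linear non-autonomous problems
under a time step restriction depending only on a bound on `‖L(t)‖` and the Lipschitz
constant of `t ↦ L(t)`. -/
theorem no_energy_stability_unique_quadrature_node
    (s : ℕ) (A : Fin s → Fin s → ℝ) (b c : Fin s → ℝ)
    (hexp : ∀ i j : Fin s, i ≤ j → A i j = 0)
    (k : Fin s) (hbk : b k ≠ 0) (hck : ∀ j : Fin s, j ≠ k → c j ≠ c k)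
    (Δt : ℝ) (hΔt : 0 < Δt) (ε : ℝ) (hε : 0 < ε)
    (u₀ : EuclideanSpace ℝ (Fin 2)) (hu₀ : u₀ ≠ 0) :
    ∃ L : ℝ → EuclideanSpace ℝ (Fin 2) →L[ℝ] EuclideanSpace ℝ (Fin 2),
      (∀ (t : ℝ) (u v : EuclideanSpace ℝ (Fin 2)), ⟪L t u, v⟫ = -⟪u, L t v⟫) ∧
      (∀ t : ℝ, ‖L t‖ ≤ ε) ∧
      (∀ t t' : ℝ, ‖L t - L t'‖ ≤ ε * |t - t'|) ∧
      ∃ u : Fin s → EuclideanSpace ℝ (Fin 2),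
        (∀ i, u i = u₀ + Δt • ∑ j, A i j • (L (c j * Δt)) (u j)) ∧
        ‖u₀ + Δt • ∑ i, b i • (L (c i * Δt)) (u i)‖ > ‖u₀‖ := by
  obtain ⟨J, hJ⟩ := exists_skew_linearIsometry
  obtain ⟨f, hfk, hfj, hfb, hfl⟩ := exists_tent (fun j => c j * Δt) k
    (fun j hj h => hck j hj (mul_right_cancel₀ hΔt.ne' h)) hε
  have hJ1 : ‖J.toContinuousLinearMap‖ ≤ 1 := J.norm_toContinuousLinearMap_le
  have hsum : ∀ (w : Fin s → ℝ) (u : Fin s → EuclideanSpace ℝ (Fin 2)),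
      ∑ j, w j • (f (c j * Δt) • J.toContinuousLinearMap) (u j) =
        w k • f (c k * Δt) • J (u k) := by
    intro w u
    rw [Finset.sum_eq_single k (fun j _ hj => by simp [hfj j hj]) (by simp)]
    simp
  have hkk : A k k = 0 := hexp k k le_rfl
  refine ⟨fun t => f t • J.toContinuousLinearMap, fun t u v => ?_, fun t => ?_, fun t t' => ?_,
    fun i => u₀ + Δt • A i k • f (c k * Δt) • J u₀, fun i => ?_, ?_⟩
  · simp [real_inner_smul_left, real_inner_smul_right, hJ u v]
  · rw [norm_smul, Real.norm_eq_abs]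
    exact (mul_le_of_le_one_right (abs_nonneg _) hJ1).trans (hfb t)
  · have hsub : f t • J.toContinuousLinearMap - f t' • J.toContinuousLinearMap =
        (f t - f t') • J.toContinuousLinearMap := by
      ext1 x
      simp [sub_smul]
    rw [hsub, norm_smul, Real.norm_eq_abs]
    exact (mul_le_of_le_one_right (abs_nonneg _) hJ1).trans (hfl t t')
  · rw [hsum]
    simp [hkk]
  · rw [hsum]
    simp only [hkk, zero_smul, smul_zero, add_zero]
    simp only [smul_smul]
    set r := Δt * (b k * f (c k * Δt))
    have hr0 : r ≠ 0 := mul_ne_zero hΔt.ne' (mul_ne_zero hbk hfk.ne')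
    have horth : ⟪u₀, J u₀⟫ = 0 := by
      linarith [hJ u₀ u₀, real_inner_comm u₀ (J u₀)]
    have hpos : 0 < ‖r • J u₀‖ := by
      rw [norm_smul, J.norm_map]
      exact mul_pos (norm_pos_iff.2 hr0) (norm_pos_iff.2 hu₀)
    have hpyth := norm_add_sq_eq_norm_sq_add_norm_sq_real
      (x := u₀) (y := r • J u₀) (by rw [real_inner_smul_right, horth, mul_zero])
    have hcalc : ‖u₀‖ * ‖u₀‖ < ‖u₀ + r • J u₀‖ * ‖u₀ + r • J u₀‖ := by
      rw [hpyth]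
      exact lt_add_of_pos_right _ (mul_pos hpos hpos)
    exact lt_of_mul_self_lt_mul_self₀ (norm_nonneg _) hcalc
end

section
/- Consider the explicit 4-stage Runge–Kutta method with nodes c = (0, 1, 0, 1), weights b = (1/4, 1/4, 1/4, 1/4), and strictly lower triangular coefficient matrix A with rows (0,0,0,0), (1,0,0,0), (1,−1,0,0), (−1,1,1,0). Let H be a real Hilbert space and let L : [0,T] → B(H) take values in the bounded linear operators on H, with: L(t₁)L(t₂) = L(t₂)L(t₁) for all t₁, t₂ ∈ [0,T]; ⟨L(t)u, v⟩ = −⟨u, L(t)v⟩ for all t ∈ [0,T] and u, v ∈ H (each L(t) is skew-adjoint); sup_{t∈[0,T]} ‖L(t)‖ < ∞; and t ↦ L(t) Lipschitz continuous in operator norm. Then for every u₀ ∈ H there exists Δt_max > 0 such that for every Δt with 0 < Δt ≤ Δt_max, the Runge–Kutta step of size Δt from u₀ applied to u'(t) = L(t)u(t) satisfies ‖u₊‖ ≤ ‖u₀‖. -/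
open scoped RealInnerProductSpace

/-- The stability polynomial of the scheme is contractive on commuting skew-adjoint operators
of small norm. -/
theorem norm_stability_polynomial_le
    {H : Type*} [NormedAddCommGroup H] [InnerProductSpace ℝ H] (X Y : H →L[ℝ] H)
    (hXY : ∀ v, X (Y v) = Y (X v))
    (hX : ∀ u v, ⟪X u, v⟫ = -⟪u, X v⟫) (hY : ∀ u v, ⟪Y u, v⟫ = -⟪u, Y v⟫)
    (hXn : ∀ v, ‖X v‖ ≤ 1 / 4 * ‖v‖) (hYn : ∀ v, ‖Y v‖ ≤ 1 / 4 * ‖v‖) (u : H) :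
    ‖u + (1 / 2 : ℝ) • (X u + Y u)
      + (1 / 4 : ℝ) • (X (X u) + Y (Y u) - X (X (Y (Y u))))‖ ≤ ‖u‖ := by
  have hX0 : ∀ v, ⟪X v, v⟫ = 0 := fun v => by
    have := hX v v
    rw [real_inner_comm (X v) v] at this
    linarith
  have hY0 : ∀ v, ⟪Y v, v⟫ = 0 := fun v => by
    have := hY v v
    rw [real_inner_comm (Y v) v] at this
    linarith
  set o : H := (1 / 2 : ℝ) • (X u + Y u) with ho
  set p : H := (1 / 4 : ℝ) • (X (X u) + Y (Y u) - X (X (Y (Y u)))) with hp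
  set d : H := X u - Y u with hd
  set w : H := X (Y u) with hw
  have huo : ⟪u, o⟫ = 0 := by
    rw [ho, inner_smul_right, inner_add_right, real_inner_comm, hX0, real_inner_comm, hY0]
    simp
  have hpo : ⟪p, o⟫ = 0 := by
    have h1 : ⟪X (X u), Y u⟫ = 0 := by
      rw [hX, hXY, real_inner_comm, hY0, neg_zero]
    have h2 : ⟪Y (Y u), X u⟫ = 0 := by
      rw [hY, ← hXY, real_inner_comm, hX0, neg_zero]
    have h3 : ⟪X (X (Y (Y u))), X u⟫ = 0 := by
      rw [hXY (Y u), hXY (X (Y u)), hY, ← hXY u, hX0, neg_zero]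
    have h4 : ⟪X (X (Y (Y u))), Y u⟫ = 0 := by
      rw [hX, hXY (Y u), hY0, neg_zero]
    rw [hp, ho, inner_smul_left, inner_smul_right, inner_sub_left, inner_add_left]
    simp only [inner_add_right, hX0, hY0, h1, h2, h3, h4]
    simp
  have hup : ⟪u, p⟫ = -(1 / 4) * (‖X u‖ ^ 2 + ‖Y u‖ ^ 2 + ‖w‖ ^ 2) := by
    have h1 : ⟪u, X (X u)⟫ = -‖X u‖ ^ 2 := by
      rw [← real_inner_self_eq_norm_sq, hX u, neg_neg]
    have h2 : ⟪u, Y (Y u)⟫ = -‖Y u‖ ^ 2 := by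
      rw [← real_inner_self_eq_norm_sq, hY u, neg_neg]
    have h3 : ⟪u, X (X (Y (Y u)))⟫ = ‖w‖ ^ 2 := by
      rw [← real_inner_self_eq_norm_sq, hw, hXY (Y u), hXY (X (Y u)), hXY u, hY, hX,
        neg_neg, ← hXY u, ← hXY (X (Y u))]
    rw [hp, inner_smul_right, inner_sub_right, inner_add_right, h1, h2, h3]
    ring
  have hoo : ‖o‖ ^ 2 = (1 / 2) * (‖X u‖ ^ 2 + ‖Y u‖ ^ 2) - (1 / 4) * ‖d‖ ^ 2 := by
    rw [ho, norm_smul, mul_pow, norm_add_sq_real, hd, norm_sub_sq_real]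
    norm_num
    ring
  have hpd : (4 : ℝ) • p = (X d - Y d) + (2 : ℝ) • w - X (Y w) := by
    rw [hp, hd, hw, hXY (Y u)]
    simp only [map_sub, hXY]
    module
  have hpn : 4 * ‖p‖ ≤ 1 / 2 * ‖d‖ + 33 / 16 * ‖w‖ := by
    have h0 : 4 * ‖p‖ = ‖(4 : ℝ) • p‖ := by rw [norm_smul (4 : ℝ) p]; norm_num
    rw [h0, hpd]
    have h1 := norm_sub_le (X d - Y d + (2 : ℝ) • w) (X (Y w))
    have h2 := norm_add_le (X d - Y d) ((2 : ℝ) • w)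
    have h3 := norm_sub_le (X d) (Y d)
    have h4 : ‖(2 : ℝ) • w‖ = 2 * ‖w‖ := by rw [norm_smul (2 : ℝ) w]; norm_num
    linarith [hXn d, hYn d, hXn (Y w), hYn w]
  have hpsq : 16 * ‖p‖ ^ 2 ≤ 4 * ‖d‖ ^ 2 + 8 * ‖w‖ ^ 2 := by
    have h1 : (4 * ‖p‖) ^ 2 ≤ (1 / 2 * ‖d‖ + 33 / 16 * ‖w‖) ^ 2 := by gcongr
    nlinarith [sq_nonneg (‖d‖ - ‖w‖), sq_nonneg ‖d‖, sq_nonneg ‖w‖]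
  refine (sq_le_sq₀ (norm_nonneg _) (norm_nonneg _)).1 ?_
  rw [norm_add_sq_real, norm_add_sq_real, inner_add_left, huo, real_inner_comm p o, hpo, hup, hoo]
  linarith

/-- Theorem 3.11: the explicit Runge--Kutta scheme with nodes `(0,1,0,1)`, weights
`(1/4,1/4,1/4,1/4)` and coefficient rows `(0,0,0,0), (1,0,0,0), (1,-1,0,0), (-1,1,1,0)`
is conditionally energy stable for linear non-autonomous problems `u' = L(t)u` where the
operators `L(t)` pairwise commute, are skew-adjoint, uniformly bounded in operator norm,
and `t ↦ L(t)` is Lipschitz continuous. -/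
theorem conditional_energy_stability_commuting_skew_adjoint
    {H : Type*} [NormedAddCommGroup H] [InnerProductSpace ℝ H] [CompleteSpace H]
    (T : ℝ) (hT : 0 < T) (L : ℝ → H →L[ℝ] H)
    (hcomm : ∀ t₁ ∈ Set.Icc (0 : ℝ) T, ∀ t₂ ∈ Set.Icc (0 : ℝ) T,
      (L t₁).comp (L t₂) = (L t₂).comp (L t₁))
    (hskew : ∀ t ∈ Set.Icc (0 : ℝ) T, ∀ u v : H, ⟪L t u, v⟫ = -⟪u, L t v⟫)
    (M : ℝ) (hM : ∀ t ∈ Set.Icc (0 : ℝ) T, ‖L t‖ ≤ M)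
    (K : ℝ) (hK : ∀ t ∈ Set.Icc (0 : ℝ) T, ∀ t' ∈ Set.Icc (0 : ℝ) T,
      ‖L t - L t'‖ ≤ K * |t - t'|)
    (u₀ : H) :
    ∃ Δtmax > (0 : ℝ), ∀ Δt : ℝ, 0 < Δt → Δt ≤ Δtmax →
      let u₁ := u₀
      let u₂ := u₀ + Δt • L 0 u₁
      let u₃ := u₀ + Δt • L 0 u₁ - Δt • L Δt u₂
      let u₄ := u₀ - Δt • L 0 u₁ + Δt • L Δt u₂ + Δt • L 0 u₃
      ‖u₀ + (Δt / 4) • (L 0 u₁ + L Δt u₂ + L 0 u₃ + L Δt u₄)‖ ≤ ‖u₀‖ := by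
  set N : ℝ := 4 * (|M| + 1) with hN
  have hN0 : 0 < N := by positivity
  refine ⟨min T (1 / N), lt_min hT (by positivity), fun h h0 hle => ?_⟩
  have hhT : h ∈ Set.Icc (0 : ℝ) T := ⟨h0.le, hle.trans (min_le_left _ _)⟩
  have h0T : (0 : ℝ) ∈ Set.Icc (0 : ℝ) T := ⟨le_rfl, hT.le⟩
  have hhN : h * N ≤ 1 := (le_div_iff₀ hN0).1 (hle.trans (min_le_right _ _))
  have hcv : ∀ v, L 0 (L h v) = L h (L 0 v) := fun v => by
    simpa using congrArg (fun f : H →L[ℝ] H => f v) (hcomm 0 h0T h hhT)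
  have hsk : ∀ t ∈ Set.Icc (0 : ℝ) T, ∀ u v : H, ⟪(h • L t) u, v⟫ = -⟪u, (h • L t) v⟫ := by
    intro t ht u v
    simp only [smul_apply, real_inner_smul_left, real_inner_smul_right,
      hskew t ht u v, mul_neg]
  have hbd : ∀ t ∈ Set.Icc (0 : ℝ) T, ∀ v : H, ‖(h • L t) v‖ ≤ 1 / 4 * ‖v‖ := by
    intro t ht v
    refine ContinuousLinearMap.le_of_opNorm_le _ ?_ v
    rw [norm_smul, Real.norm_of_nonneg h0.le]
    have hLM : ‖L t‖ ≤ |M| + 1 := by linarith [hM t ht, le_abs_self M]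
    have := mul_le_mul_of_nonneg_left hLM h0.le
    rw [hN] at hhN
    linarith
  convert norm_stability_polynomial_le (h • L 0) (h • L h)
    (fun v => by simp only [smul_apply, map_smul, hcv])
    (hsk 0 h0T) (hsk h hhT) (hbd 0 h0T) (hbd h hhT) u₀ using 2
  simp only [smul_apply, map_smul, map_add, map_sub, hcv]
  module
end

section
/- Let (A, b, c) be an explicit Butcher tableau with s stages, and suppose there is an index k with b_k ≠ 0 such that for every j ≠ k the difference c_j − c_k is not an integer. Then for every Δt > 0 there exists a map L : ℝ → M₂(ℝ) with L(t) skew-symmetric for all t (so ⟨u, L(t)u⟩ = 0 for all u, i.e. the linear problem u' = L(t)u is semibounded) such that for every u₀ ∈ ℝ² with u₀ ≠ 0, the Runge–Kutta iterates u⁽⁰⁾ = u₀, u⁽ⁿ⁺¹⁾ obtained by one step of size Δt from u⁽ⁿ⁾ starting at time nΔt satisfy ‖u⁽ⁿ⁺¹⁾‖ > ‖u⁽ⁿ⁾‖ for every n ∈ ℕ, and ‖u⁽ⁿ⁾‖ → ∞ as n → ∞. -/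
open scoped RealInnerProductSpace
open Filter

/-- Rotation of the Euclidean plane by a right angle. -/
noncomputable def planeRotation : EuclideanSpace ℝ (Fin 2) →L[ℝ] EuclideanSpace ℝ (Fin 2) :=
  Matrix.toEuclideanCLM (n := Fin 2) (𝕜 := ℝ) !![0, -1; 1, 0]

lemma planeRotation_apply_zero (u : EuclideanSpace ℝ (Fin 2)) : planeRotation u 0 = -u 1 := by
  simp [planeRotation, Matrix.ofLp_toEuclideanCLM, Matrix.mulVec, dotProduct, Fin.sum_univ_two]

lemma planeRotation_apply_one (u : EuclideanSpace ℝ (Fin 2)) : planeRotation u 1 = u 0 := by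
  simp [planeRotation, Matrix.ofLp_toEuclideanCLM, Matrix.mulVec, dotProduct, Fin.sum_univ_two]

lemma inner_planeRotation_left (u v : EuclideanSpace ℝ (Fin 2)) :
    ⟪planeRotation u, v⟫ = -⟪u, planeRotation v⟫ := by
  simp only [PiLp.inner_apply, Fin.sum_univ_two, planeRotation_apply_zero,
    planeRotation_apply_one, RCLike.inner_apply, conj_trivial]
  ring

lemma norm_add_smul_planeRotation (r : ℝ) (u : EuclideanSpace ℝ (Fin 2)) :
    ‖u + r • planeRotation u‖ = √(1 + r ^ 2) * ‖u‖ := by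
  rw [EuclideanSpace.norm_eq, EuclideanSpace.norm_eq, ← Real.sqrt_mul (by positivity)]
  congr 1
  simp only [Fin.sum_univ_two, PiLp.add_apply, PiLp.smul_apply, planeRotation_apply_zero,
    planeRotation_apply_one, Real.norm_eq_abs, sq_abs, smul_eq_mul]
  ring

/-- Theorem 3.8 (unbounded growth): for an explicit Runge--Kutta method possessing a
quadrature node `c_k` such that `c_j - c_k` is never an integer for `j ≠ k`, there is a
semibounded linear non-autonomous problem `u' = L(t)u` (with `L(t)` skew-symmetric) for
which the numerical solution grows monotonically without bound. -/
theorem unbounded_growth_of_numerical_solution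
    (s : ℕ) (A : Fin s → Fin s → ℝ) (b c : Fin s → ℝ)
    (hexp : ∀ i j : Fin s, i ≤ j → A i j = 0)
    (k : Fin s) (hbk : b k ≠ 0)
    (hck : ∀ j : Fin s, j ≠ k → ∀ m : ℤ, c j - c k ≠ (m : ℝ))
    (Δt : ℝ) (hΔt : 0 < Δt) :
    ∃ L : ℝ → EuclideanSpace ℝ (Fin 2) →L[ℝ] EuclideanSpace ℝ (Fin 2),
      (∀ (t : ℝ) (u v : EuclideanSpace ℝ (Fin 2)), ⟪L t u, v⟫ = -⟪u, L t v⟫) ∧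
      ∀ u₀ : EuclideanSpace ℝ (Fin 2), u₀ ≠ 0 →
        ∀ (u : ℕ → EuclideanSpace ℝ (Fin 2)) (v : ℕ → Fin s → EuclideanSpace ℝ (Fin 2)),
          u 0 = u₀ →
          (∀ n i, v n i = u n + Δt • ∑ j, A i j • (L (((n : ℝ) + c j) * Δt)) (v n j)) →
          (∀ n, u (n + 1) = u n + Δt • ∑ i, b i • (L (((n : ℝ) + c i) * Δt)) (v n i)) →
          (∀ n, ‖u (n + 1)‖ > ‖u n‖) ∧
          Tendsto (fun n => ‖u n‖) atTop atTop := by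
  classical
  let L : ℝ → EuclideanSpace ℝ (Fin 2) →L[ℝ] EuclideanSpace ℝ (Fin 2) := fun t =>
    if ∃ m : ℤ, t = ((m : ℝ) + c k) * Δt then planeRotation else 0
  have L_node (n : ℕ) : L (((n : ℝ) + c k) * Δt) = planeRotation :=
    if_pos ⟨n, by simp⟩
  have L_other (n : ℕ) (j : Fin s) (hj : j ≠ k) : L (((n : ℝ) + c j) * Δt) = 0 := by
    refine if_neg ?_
    rintro ⟨m, hm⟩
    have h := mul_right_cancel₀ hΔt.ne' hm
    refine hck j hj (m - n) ?_
    push_cast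
    linarith
  refine ⟨L, fun t u v => ?_, fun u₀ hu₀ u v hu0 hv hu => ?_⟩
  · by_cases h : ∃ m : ℤ, t = ((m : ℝ) + c k) * Δt
    · simpa [L, h] using inner_planeRotation_left u v
    · simp [L, h]
  have stage_eq (n : ℕ) : v n k = u n := by
    rw [hv, Finset.sum_eq_zero, smul_zero, add_zero]
    intro j _
    rcases eq_or_ne j k with rfl | hj
    · simp [hexp j j le_rfl]
    · simp [L_other n j hj]
  have norm_step (n : ℕ) : ‖u (n + 1)‖ = √(1 + (Δt * b k) ^ 2) * ‖u n‖ := by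
    rw [hu, Finset.sum_eq_single k (fun j _ hj => by simp [L_other n j hj]) (by simp),
      L_node, stage_eq, smul_smul, norm_add_smul_planeRotation]
  have one_lt : 1 < √(1 + (Δt * b k) ^ 2) := by
    rw [Real.lt_sqrt zero_le_one]
    have : 0 < (Δt * b k) ^ 2 := by positivity
    linarith
  have norm_eq (n : ℕ) : ‖u n‖ = √(1 + (Δt * b k) ^ 2) ^ n * ‖u₀‖ := by
    induction n with
    | zero => simp [hu0]
    | succ n ih => rw [norm_step, ih, pow_succ]; ring
  have norm_pos : 0 < ‖u₀‖ := norm_pos_iff.mpr hu₀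
  refine ⟨fun n => ?_, ?_⟩
  · rw [norm_step, gt_iff_lt]
    refine lt_mul_of_one_lt_left ?_ one_lt
    rw [norm_eq]
    positivity
  · simp_rw [norm_eq]
    exact (tendsto_pow_atTop_atTop_of_one_lt one_lt).atTop_mul_const norm_pos
end

section
/- Let (A, b, c) be a Butcher tableau with s stages (not necessarily explicit) whose nodes c₁, …, c_s are pairwise distinct (non-confluent). Suppose the method is energy stable for semibounded linear problems under a time step restriction depending only on an operator norm bound and a Lipschitz constant, i.e.: for every M > 0 there exists Δt_max(M) > 0 such that whenever L : ℝ → M₂(ℝ) satisfies ‖L(t)‖ ≤ M, ‖L(t) − L(s)‖ ≤ M|t − s|, and ⟨u, L(t)u⟩ ≤ 0 for all t, s ∈ ℝ and all u ∈ ℝ², and 0 < Δt ≤ Δt_max(M), then every family of stage values u₁, …, u_s satisfying the stage equations with initial value u₀ yields an update u₊ with ‖u₊‖ ≤ ‖u₀‖. Then the method is algebraically stable: b_i ≥ 0 for all i, and the s×s matrix with entries (b_i b_j − b_i a_{ij} − b_j a_{ji}) is negative semidefinite, i.e. Σ_{i,j=1}^s (b_i b_j − b_i a_{ij} − b_j a_{ji})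 ξ_i ξ_j ≤ 0 for all ξ ∈ ℝ^s. -/
open scoped RealInnerProductSpace

open Filter Topology

/-- Energy stability of the Runge-Kutta method `(A, b, c)` for semibounded linear problems on `E`,
under a step size bound depending only on a bound and a Lipschitz constant of the operator. -/
def IsLinearlyEnergyStable (E : Type*) [NormedAddCommGroup E] [InnerProductSpace ℝ E]
    {s : ℕ} (A : Fin s → Fin s → ℝ) (b c : Fin s → ℝ) : Prop :=
  ∀ M : ℝ, 0 < M → ∃ Δtmax > (0 : ℝ), ∀ L : ℝ → E →L[ℝ] E,
    (∀ t : ℝ, ‖L t‖ ≤ M) →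
    (∀ t t' : ℝ, ‖L t - L t'‖ ≤ M * |t - t'|) →
    (∀ (t : ℝ) (u : E), ⟪u, L t u⟫ ≤ 0) →
    ∀ Δt : ℝ, 0 < Δt → Δt ≤ Δtmax → ∀ (u₀ : E) (u : Fin s → E),
      (∀ i, u i = u₀ + Δt • ∑ j, A i j • (L (c j * Δt)) (u j)) →
      ‖u₀ + Δt • ∑ i, b i • (L (c i * Δt)) (u i)‖ ≤ ‖u₀‖

/-- Values in `[m, m']` at finitely many distinct nodes are interpolated by a Lipschitz function
with values in `[m, m']`. -/
theorem exists_lipschitzWith_interpolant {ι : Type*} [Fintype ι] {c : ι → ℝ}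
    (hc : Function.Injective c) {m m' : ℝ} (hm : m ≤ m') {ξ : ι → ℝ}
    (hξ : ∀ i, ξ i ∈ Set.Icc m m') :
    ∃ (K : NNReal) (p : ℝ → ℝ), LipschitzWith K p ∧ (∀ t, p t ∈ Set.Icc m m') ∧
      ∀ i, p (c i) = ξ i := by
  classical
  set K : NNReal := ∑ i, ∑ j, Real.toNNReal (|ξ i - ξ j| / |c i - c j|)
  have hle : ∀ i j, |ξ i - ξ j| ≤ K * |c i - c j| := by
    intro i j
    rcases eq_or_ne i j with rfl | hij
    · simp
    have hpos : 0 < |c i - c j| := abs_pos.2 (sub_ne_zero.2 (hc.ne hij))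
    have h1 : Real.toNNReal (|ξ i - ξ j| / |c i - c j|) ≤ K :=
      (Finset.single_le_sum (f := fun j => Real.toNNReal (|ξ i - ξ j| / |c i - c j|))
        (fun _ _ => zero_le) (Finset.mem_univ j)).trans
      (Finset.single_le_sum
        (f := fun i => ∑ j, Real.toNNReal (|ξ i - ξ j| / |c i - c j|))
        (fun _ _ => zero_le) (Finset.mem_univ i))
    exact (div_le_iff₀ hpos).1 (Real.toNNReal_le_iff_le_coe.1 h1)
  have hext : LipschitzOnWith K (Function.extend c ξ 0) (Set.range c) := by
    refine LipschitzOnWith.of_dist_le_mul ?_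
    rintro _ ⟨i, rfl⟩ _ ⟨j, rfl⟩
    simpa [hc.extend_apply, Real.dist_eq] using hle i j
  obtain ⟨g, hg, hgc⟩ := hext.extend_real
  refine ⟨K, fun t => max m (min m' (g t)), ?_, fun t => ⟨le_max_left _ _, ?_⟩, fun i => ?_⟩
  · simpa using (hg.const_min m').const_max m
  · exact max_le hm (min_le_left _ _)
  · have : g (c i) = ξ i := by rw [← hgc ⟨i, rfl⟩, hc.extend_apply]
    simp [this, (hξ i).1, (hξ i).2]

/-- The equation `u = v + h • T u` has, for small `h`, a solution that tends to `v` as `h → 0`. -/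
theorem exists_tendsto_solution {V : Type*} [NormedAddCommGroup V] [NormedSpace ℝ V]
    [CompleteSpace V] (T : V →L[ℝ] V) (v : V) :
    ∃ u : ℝ → V, Tendsto u (𝓝 0) (𝓝 v) ∧ ∀ᶠ h in 𝓝 0, u h = v + h • T (u h) := by
  have hcont : Tendsto (fun h : ℝ => (1 : V →L[ℝ] V) - h • T) (𝓝 0) (𝓝 1) := by
    have : Continuous fun h : ℝ => (1 : V →L[ℝ] V) - h • T := by fun_prop
    simpa using this.tendsto 0
  refine ⟨fun h => Ring.inverse ((1 : V →L[ℝ] V) - h • T) v, ?_, ?_⟩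
  · have hinv := (NormedRing.inverse_continuousAt (1 : (V →L[ℝ] V)ˣ)).tendsto.comp hcont
    simp only [Units.val_one, Ring.inverse_one] at hinv
    simpa [Function.comp_def] using ((ContinuousLinearMap.apply ℝ V v).continuous.tendsto _).comp hinv
  · have hu : ∀ᶠ x in 𝓝 (1 : V →L[ℝ] V), IsUnit x := Units.isOpen.mem_nhds isUnit_one
    filter_upwards [hcont.eventually hu] with h hh
    have := congrArg (fun S : V →L[ℝ] V => S v) (Ring.mul_inverse_cancel _ hh)
    simpa [sub_eq_iff_eq_add] using this

section

variable {E : Type*} [NormedAddCommGroup E] [InnerProductSpace ℝ E]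
  {s : ℕ} {A : Fin s → Fin s → ℝ} {b c : Fin s → ℝ}

/-- Rescaling time in `p` produces, for all small steps `τ`, an admissible problem whose operators
at the nodes are `τ • p (c i) • B`. -/
theorem IsLinearlyEnergyStable.exists_stages [CompleteSpace E]
    (hst : IsLinearlyEnergyStable E A b c) (B : E →L[ℝ] E) {p : ℝ → ℝ} {K : NNReal} {C : ℝ}
    (hp : LipschitzWith K p) (hpC : ∀ t, |p t| ≤ C) (hB : ∀ t u, p t * ⟪u, B u⟫ ≤ 0) (u₀ : E) :
    ∃ u : ℝ → Fin s → E, Tendsto u (𝓝[>] 0) (𝓝 fun _ => u₀) ∧ ∀ᶠ τ in 𝓝[>] (0 : ℝ),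
      (∀ i, u τ i = u₀ + τ ^ 2 • ∑ j, A i j • p (c j) • B (u τ j)) ∧
      ‖u₀ + τ ^ 2 • ∑ i, b i • p (c i) • B (u τ i)‖ ≤ ‖u₀‖ := by
  set T : (Fin s → E) →L[ℝ] (Fin s → E) := ContinuousLinearMap.pi fun i =>
    ∑ j, A i j • p (c j) • B.comp (ContinuousLinearMap.proj (R := ℝ) (φ := fun _ : Fin s => E) j)
  have hT : ∀ v i, T v i = ∑ j, A i j • p (c j) • B (v j) := by
    intro v i
    simp [T]
  obtain ⟨v, hv, hveq⟩ := exists_tendsto_solution T fun _ => u₀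
  have hsq : Tendsto (fun τ : ℝ => τ ^ 2) (𝓝[>] 0) (𝓝 0) := by
    have : Continuous fun τ : ℝ => τ ^ 2 := by fun_prop
    simpa using (this.tendsto 0).mono_left nhdsWithin_le_nhds
  have hC : 0 ≤ C := (abs_nonneg _).trans (hpC 0)
  obtain ⟨δ, hδ, hstab⟩ := hst ((C + K) * ‖B‖ + 1) (by positivity)
  refine ⟨fun τ => v (τ ^ 2), hv.comp hsq, ?_⟩
  filter_upwards [hsq.eventually hveq, Ioc_mem_nhdsGT (lt_min hδ one_pos)] with τ hτ hτδ
  have hτ0 : 0 < τ := hτδ.1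
  have hτ1 : τ ≤ 1 := hτδ.2.trans (min_le_right _ _)
  have heq : ∀ i, v (τ ^ 2) i = u₀ + τ ^ 2 • ∑ j, A i j • p (c j) • B (v (τ ^ 2) j) := by
    intro i
    conv_lhs => rw [hτ]
    simp [hT]
  have hscale : ∀ d : Fin s → ℝ, τ • ∑ j, d j • ((τ * p (c j * τ / τ)) • B) (v (τ ^ 2) j) =
      τ ^ 2 • ∑ j, d j • p (c j) • B (v (τ ^ 2) j) := by
    intro d
    rw [Finset.smul_sum, Finset.smul_sum]
    refine Finset.sum_congr rfl fun j _ => ?_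
    rw [mul_div_cancel_right₀ _ hτ0.ne', smul_apply]
    simp only [smul_smul]
    congr 1
    ring
  refine ⟨heq, ?_⟩
  have := hstab (fun t => (τ * p (t / τ)) • B) ?_ ?_ ?_ τ hτ0 (hτδ.2.trans (min_le_left _ _)) u₀
    (v (τ ^ 2)) (fun i => by rw [hscale]; exact heq i)
  · rwa [hscale] at this
  · intro t
    rw [norm_smul, Real.norm_eq_abs, abs_mul, abs_of_pos hτ0]
    have h1 : τ * |p (t / τ)| ≤ 1 * C := by gcongr; exact hpC _
    have h2 : τ * |p (t / τ)| ≤ C + K := by linarith [K.coe_nonneg]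
    nlinarith [mul_le_mul_of_nonneg_right h2 (norm_nonneg B)]
  · intro t t'
    rw [← sub_smul, norm_smul, Real.norm_eq_abs, ← mul_sub, abs_mul, abs_of_pos hτ0]
    have h1 : |p (t / τ) - p (t' / τ)| ≤ K * |t / τ - t' / τ| := by
      simpa [Real.dist_eq] using hp.dist_le_mul (t / τ) (t' / τ)
    have h2 : τ * |p (t / τ) - p (t' / τ)| ≤ K * |t - t'| := by
      rw [← sub_div, abs_div, abs_of_pos hτ0] at h1
      calc _ ≤ τ * (K * (|t - t'| / τ)) := by gcongr
        _ = _ := by field_simp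
    calc _ ≤ K * |t - t'| * ‖B‖ := by gcongr
      _ ≤ ((C + K) * ‖B‖ + 1) * |t - t'| := by
        nlinarith [mul_nonneg (mul_nonneg hC (norm_nonneg B)) (abs_nonneg (t - t')),
          abs_nonneg (t - t')]
  · intro t u
    rw [smul_apply, inner_smul_right, mul_assoc]
    exact mul_nonpos_of_nonneg_of_nonpos hτ0.le (hB _ _)

/-- The inequality `‖u₀ + h • w‖ ≤ ‖u₀‖`, expanded and divided by `h`. -/
theorem two_mul_inner_add_le_of_norm_add_smul_le {u₀ w : E} {h : ℝ} (hh : 0 < h)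
    (hle : ‖u₀ + h • w‖ ≤ ‖u₀‖) : 2 * ⟪u₀, w⟫ + h * ⟪w, w⟫ ≤ 0 := by
  have h1 : ‖u₀ + h • w‖ ^ 2 ≤ ‖u₀‖ ^ 2 := by gcongr
  rw [norm_add_sq_real, inner_smul_right, norm_smul, mul_pow, Real.norm_eq_abs, sq_abs,
    ← real_inner_self_eq_norm_sq w] at h1
  have h2 : h * (2 * ⟪u₀, w⟫ + h * ⟪w, w⟫) ≤ 0 := by linarith
  exact nonpos_of_mul_nonpos_right h2 hh

theorem IsLinearlyEnergyStable.weights_nonneg [CompleteSpace E] [Nontrivial E]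
    (hst : IsLinearlyEnergyStable E A b c) (hc : Function.Injective c) (i : Fin s) : 0 ≤ b i := by
  obtain ⟨K, p, hp, hpm, hpc⟩ := exists_lipschitzWith_interpolant hc (zero_le_one' ℝ)
    (ξ := Pi.single i 1) fun j => by
      rcases eq_or_ne j i with rfl | h <;> simp [*]
  obtain ⟨u₀, hu₀⟩ := exists_ne (0 : E)
  obtain ⟨u, hu, hev⟩ := hst.exists_stages (-ContinuousLinearMap.id ℝ E) hp (C := 1)
    (fun t => abs_le.2 ⟨by linarith [(hpm t).1], (hpm t).2⟩)
    (fun t u => by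
      simpa using mul_nonneg (hpm t).1 (real_inner_self_nonneg (x := u))) u₀
  have hlim : Tendsto (fun τ => 2 * ⟪u₀, -(b i • u τ i)⟫ +
      τ ^ 2 * ⟪-(b i • u τ i), -(b i • u τ i)⟫) (𝓝[>] 0)
      (𝓝 (2 * ⟪u₀, -(b i • u₀)⟫ + 0 ^ 2 * ⟪-(b i • u₀), -(b i • u₀)⟫)) := by
    have hτ : Tendsto (fun τ : ℝ => τ) (𝓝[>] 0) (𝓝 0) := nhdsWithin_le_nhds
    have hw := ((tendsto_pi_nhds.1 hu i).const_smul (b i)).neg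
    exact ((tendsto_const_nhds.inner hw).const_mul 2).add ((hτ.pow 2).mul (hw.inner hw))
  have hle := le_of_tendsto hlim (b := 0) <| by
    filter_upwards [hev, self_mem_nhdsWithin] with τ hτ hτ0
    refine two_mul_inner_add_le_of_norm_add_smul_le (pow_pos hτ0 2) ?_
    have hsum : ∑ j, b j • p (c j) • (-ContinuousLinearMap.id ℝ E) (u τ j) = -(b i • u τ i) := by
      rw [Finset.sum_eq_single i] <;> simp +contextual [hpc]
    exact hsum ▸ hτ.2
  have hpos : 0 < ⟪u₀, u₀⟫ := real_inner_self_pos.2 hu₀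
  simp only [inner_neg_right, inner_smul_right] at hle
  by_contra! hneg
  nlinarith

theorem IsLinearlyEnergyStable.quadraticForm_nonpos [CompleteSpace E]
    (hst : IsLinearlyEnergyStable E A b c) (hc : Function.Injective c) {B : E →L[ℝ] E}
    (hB : ∀ u, ⟪u, B u⟫ = 0) (hB0 : B ≠ 0) (ξ : Fin s → ℝ) :
    ∑ i, ∑ j, (b i * b j - b i * A i j - b j * A j i) * ξ i * ξ j ≤ 0 := by
  set C : ℝ := ∑ i, |ξ i|
  have hξ : ∀ i, |ξ i| ≤ C := fun i =>
    Finset.single_le_sum (f := fun i => |ξ i|) (fun _ _ => abs_nonneg _) (Finset.mem_univ i)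
  have hC : 0 ≤ C := Finset.sum_nonneg fun _ _ => abs_nonneg _
  obtain ⟨K, p, hp, hpm, hpc⟩ := exists_lipschitzWith_interpolant hc (neg_le_self hC)
    fun i => abs_le.1 (hξ i)
  obtain ⟨u₀, hu₀⟩ : ∃ u, B u ≠ 0 := by
    by_contra! h
    exact hB0 (ContinuousLinearMap.ext h)
  obtain ⟨u, hu, hev⟩ := hst.exists_stages B hp (fun t => abs_le.2 (hpm t))
    (fun t u => by simp [hB]) u₀
  simp only [hpc] at hev
  have hlim : Tendsto (fun τ => ∑ i, ∑ j, (b i * b j - 2 * b i * A i j) *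
      ⟪ξ i • B (u τ i), ξ j • B (u τ j)⟫) (𝓝[>] 0)
      (𝓝 (∑ i, ∑ j, (b i * b j - 2 * b i * A i j) * ⟪ξ i • B u₀, ξ j • B u₀⟫)) := by
    have hk : ∀ i, Tendsto (fun τ => ξ i • B (u τ i)) (𝓝[>] 0) (𝓝 (ξ i • B u₀)) := fun i =>
      ((B.continuous.tendsto _).comp (tendsto_pi_nhds.1 hu i)).const_smul (ξ i)
    exact tendsto_finsetSum _ fun i _ => tendsto_finsetSum _ fun j _ =>
      ((hk i).inner (hk j)).const_mul _
  have hle := le_of_tendsto hlim (b := 0) <| by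
    filter_upwards [hev, self_mem_nhdsWithin] with τ ⟨hstage, hnorm⟩ hτ0
    have hτ2 : 0 < τ ^ 2 := pow_pos hτ0 2
    have hen := two_mul_inner_add_le_of_norm_add_smul_le hτ2 hnorm
    have hu₀k : ∀ i, ⟪u₀, ξ i • B (u τ i)⟫ =
        -(τ ^ 2 * ∑ j, A i j * ⟪ξ i • B (u τ i), ξ j • B (u τ j)⟫) := by
      intro i
      have h0 : ⟪u τ i, ξ i • B (u τ i)⟫ = 0 := by rw [inner_smul_right, hB, mul_zero]
      have h1 : ⟪∑ j, A i j • ξ j • B (u τ j), ξ i • B (u τ i)⟫ =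
          ∑ j, A i j * ⟪ξ i • B (u τ i), ξ j • B (u τ j)⟫ := by
        rw [sum_inner]
        refine Finset.sum_congr rfl fun j _ => ?_
        rw [real_inner_smul_left, real_inner_comm]
      have h2 : ⟪u τ i, ξ i • B (u τ i)⟫ = ⟪u₀, ξ i • B (u τ i)⟫ +
          τ ^ 2 * ∑ j, A i j * ⟪ξ i • B (u τ i), ξ j • B (u τ j)⟫ := by
        rw [← h1, ← real_inner_smul_left, ← inner_add_left, ← hstage i]
      linarith
    refine nonpos_of_mul_nonpos_right (a := τ ^ 2) (le_of_eq_of_le ?_ hen) hτ2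
    have hcross : ⟪u₀, ∑ i, b i • ξ i • B (u τ i)⟫ =
        ∑ i, ∑ j, -(b i * (τ ^ 2 * (A i j * ⟪ξ i • B (u τ i), ξ j • B (u τ j)⟫))) := by
      rw [inner_sum]
      refine Finset.sum_congr rfl fun i _ => ?_
      rw [inner_smul_right, hu₀k, Finset.sum_neg_distrib, mul_neg, Finset.mul_sum, Finset.mul_sum]
    have hsq : ⟪∑ i, b i • ξ i • B (u τ i), ∑ i, b i • ξ i • B (u τ i)⟫ =
        ∑ i, ∑ j, b i * (b j * ⟪ξ i • B (u τ i), ξ j • B (u τ j)⟫) := by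
      rw [sum_inner]
      refine Finset.sum_congr rfl fun i _ => ?_
      rw [real_inner_smul_left, inner_sum, Finset.mul_sum]
      exact Finset.sum_congr rfl fun j _ => by rw [inner_smul_right]
    rw [hcross, hsq]
    simp_rw [Finset.mul_sum, ← Finset.sum_add_distrib]
    exact Finset.sum_congr rfl fun i _ => Finset.sum_congr rfl fun j _ => by ring
  have hpos : 0 < ⟪B u₀, B u₀⟫ := real_inner_self_pos.2 hu₀
  refine nonpos_of_mul_nonpos_right (a := ⟪B u₀, B u₀⟫) (le_of_eq_of_le ?_ hle) hpos
  have hsymm : ∑ i, ∑ j, b j * A j i * ξ i * ξ j = ∑ i, ∑ j, b i * A i j * ξ i * ξ j := by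
    rw [Finset.sum_comm]
    exact Finset.sum_congr rfl fun i _ => Finset.sum_congr rfl fun j _ => by ring
  have hsum : ∑ i, ∑ j, (b i * b j - b i * A i j - b j * A j i) * ξ i * ξ j =
      ∑ i, ∑ j, (b i * b j - 2 * b i * A i j) * ξ i * ξ j := by
    rw [← sub_eq_zero]
    simp_rw [← Finset.sum_sub_distrib]
    calc _ = ∑ i, ∑ j, (b i * A i j * ξ i * ξ j - b j * A j i * ξ i * ξ j) :=
          Finset.sum_congr rfl fun i _ => Finset.sum_congr rfl fun j _ => by ring
      _ = 0 := by simp_rw [Finset.sum_sub_distrib, hsymm, sub_self]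
  rw [hsum]
  simp_rw [Finset.mul_sum, inner_smul_right, real_inner_smul_left]
  exact Finset.sum_congr rfl fun i _ => Finset.sum_congr rfl fun j _ => by ring

end

/-- Theorem 3.10: a non-confluent Runge--Kutta method that is energy stable for semibounded
linear non-autonomous problems under a time step restriction depending only on a bound of
`‖L(t)‖` and the Lipschitz constant of `t ↦ L(t)` must be algebraically stable. -/
theorem nonconfluent_energy_stable_implies_algebraically_stable
    (s : ℕ) (A : Fin s → Fin s → ℝ) (b c : Fin s → ℝ)
    (hc : Function.Injective c)
    (hstable : ∀ M : ℝ, 0 < M → ∃ Δtmax > (0 : ℝ),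
      ∀ L : ℝ → EuclideanSpace ℝ (Fin 2) →L[ℝ] EuclideanSpace ℝ (Fin 2),
        (∀ t : ℝ, ‖L t‖ ≤ M) →
        (∀ t t' : ℝ, ‖L t - L t'‖ ≤ M * |t - t'|) →
        (∀ (t : ℝ) (u : EuclideanSpace ℝ (Fin 2)), ⟪u, L t u⟫ ≤ 0) →
        ∀ Δt : ℝ, 0 < Δt → Δt ≤ Δtmax →
        ∀ (u₀ : EuclideanSpace ℝ (Fin 2)) (u : Fin s → EuclideanSpace ℝ (Fin 2)),
          (∀ i, u i = u₀ + Δt • ∑ j, A i j • (L (c j * Δt)) (u j)) →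
          ‖u₀ + Δt • ∑ i, b i • (L (c i * Δt)) (u i)‖ ≤ ‖u₀‖) :
    (∀ i, 0 ≤ b i) ∧
    ∀ ξ : Fin s → ℝ,
      ∑ i, ∑ j, (b i * b j - b i * A i j - b j * A j i) * ξ i * ξ j ≤ 0 := by
  have hst : IsLinearlyEnergyStable (EuclideanSpace ℝ (Fin 2)) A b c := hstable
  set J : EuclideanSpace ℝ (Fin 2) →L[ℝ] EuclideanSpace ℝ (Fin 2) :=
    Matrix.toEuclideanCLM (𝕜 := ℝ) !![0, -1; 1, 0] with hJ
  refine ⟨hst.weights_nonneg hc, hst.quadraticForm_nonpos hc (B := J) (fun u => ?_) ?_⟩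
  · simp [hJ, PiLp.inner_apply, Fin.sum_univ_two, Matrix.ofLp_toEuclideanCLM, Matrix.mulVec,
      dotProduct]
    ring
  · rw [hJ, Ne, EmbeddingLike.map_eq_zero_iff]
    intro h
    simpa using congrFun (congrFun h 1) 0
end

section
/- Consider the explicit 3-stage Runge–Kutta method with nodes c = (0, 1, 0), weights b = (−1/2, 0, 3/2), and strictly lower triangular coefficient matrix A with rows (0,0,0), (1,0,0), (1,−1,0). Let H be a real inner product space, let L₀ : H → H be a linear map with ⟨L₀u, v⟩ = −⟨u, L₀v⟩ for all u, v ∈ H (skew-adjoint), and consider the linear problem u'(t) = L(t)u(t) with L(0) = L₀ and L(Δt) = 0. Then the Runge–Kutta step of size Δt from u₀, namely u₁ = u₀, u₂ = u₀ + Δt L₀ u₁, u₃ = u₀ + Δt L₀ u₁, u₊ = u₀ + (Δt/2) L₀ (−u₁ + 3u₃), satisfies u₊ = u₀ + Δt L₀ u₀ + (3/2) Δt² L₀² u₀ and ‖u₊‖² − ‖u₀‖² = −2 Δt² ‖L₀ u₀‖² + (9/4) Δt⁴ ‖L₀² u₀‖². -/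
open scoped RealInnerProductSpace

/-- Remark 3.6 computation: for the explicit 3-stage method with nodes `(0,1,0)`, weights
`(-1/2, 0, 3/2)` and rows `(0,0,0), (1,0,0), (1,-1,0)` applied to `u' = L(t)u` with
`L(0) = L₀` skew-adjoint and `L(Δt) = 0`, the update equals
`u₀ + Δt L₀ u₀ + (3/2) Δt² L₀² u₀` and the energy change is
`-2 Δt² ‖L₀ u₀‖² + (9/4) Δt⁴ ‖L₀² u₀‖²`. -/
theorem energy_change_counterexample_scheme
    {H : Type*} [NormedAddCommGroup H] [InnerProductSpace ℝ H]
    (L₀ : H →ₗ[ℝ] H)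
    (hskew : ∀ u v : H, ⟪L₀ u, v⟫ = -⟪u, L₀ v⟫)
    (Δt : ℝ) (u₀ : H)
    (u₁ u₂ u₃ uplus : H)
    (hu₁ : u₁ = u₀)
    (hu₂ : u₂ = u₀ + Δt • L₀ u₁)
    (hu₃ : u₃ = u₀ + Δt • L₀ u₁)
    (huplus : uplus = u₀ + (Δt / 2) • L₀ (-u₁ + (3 : ℝ) • u₃)) :
    uplus = u₀ + Δt • L₀ u₀ + ((3 / 2) * Δt ^ 2) • L₀ (L₀ u₀) ∧
    ‖uplus‖ ^ 2 - ‖u₀‖ ^ 2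
      = -2 * Δt ^ 2 * ‖L₀ u₀‖ ^ 2 + (9 / 4) * Δt ^ 4 * ‖L₀ (L₀ u₀)‖ ^ 2 := by
  have hself (v : H) : ⟪v, L₀ v⟫ = 0 := by
    have h := hskew v v
    rw [real_inner_comm] at h
    linarith
  have hsq : ⟪u₀, L₀ (L₀ u₀)⟫ = -‖L₀ u₀‖ ^ 2 := by
    have h := hskew u₀ (L₀ u₀)
    rw [real_inner_self_eq_norm_sq] at h
    linarith
  have hupdate : uplus = u₀ + Δt • L₀ u₀ + ((3 / 2) * Δt ^ 2) • L₀ (L₀ u₀) := by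
    rw [huplus, hu₃, hu₁]
    simp only [map_add, map_neg, map_smul]
    module
  refine ⟨hupdate, ?_⟩
  rw [hupdate, norm_add_sq_real, norm_add_sq_real]
  simp only [inner_add_left, real_inner_smul_left, real_inner_smul_right, hself, hsq, norm_smul,
    mul_pow, Real.norm_eq_abs, sq_abs]
  ring
end

section
/- Fix k ∈ ℕ with k ≥ 1. Define f : ℝ³ → ℝ³ by f(u) = (1, −u₁ᵏ u₃, u₁ᵏ u₂), let u₀ = (0, 1, 0), and equip ℝ³ with the semi inner product ⟨u, v⟩_P = u₂v₂ + u₃v₃ (induced by P = diag(0,1,1)). Then: (i) ⟨u, f(u)⟩_P = 0 for every u ∈ ℝ³; (ii) f(u₀) = (1, 0, 0) ≠ 0; (iii) for every l ≥ 1, the l-th iterated (Fréchet) derivative of f at u₀ applied to l copies of f(u₀) satisfies D^l f(u₀)[f(u₀), …, f(u₀)] = k!·(0, 0, 1) if l = k, and D^l f(u₀)[f(u₀), …, f(u₀)] = 0 if l ≠ k. In particular the elementary differential f^{(k)}(f, …, f) at u₀ is nonzero and has positive seminorm, while f^{(l)}(f, …, f) = 0 at u₀ for all l ≥ 1 with l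 ≠ k, and ⟨f(u₀), D^k f(u₀)[f(u₀), …, f(u₀)]⟩_P = 0. -/
/-- The semi inner product on `ℝ³` induced by `P = diag(0,1,1)`. -/
def sipP (u v : Fin 3 → ℝ) : ℝ := u 1 * v 1 + u 2 * v 2

/-- The iterated Fréchet derivative along a single direction is the iterated derivative of the
restriction to the line in that direction. -/
theorem iteratedFDeriv_const_apply_eq_iteratedDeriv {E F : Type*}
    [NormedAddCommGroup E] [NormedSpace ℝ E] [NormedAddCommGroup F] [NormedSpace ℝ F]
    {f : E → F} {n : ℕ} (hf : ContDiff ℝ n f) (x v : E) :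
    iteratedFDeriv ℝ n f x (fun _ => v) = iteratedDeriv n (fun t : ℝ => f (x + t • v)) 0 := by
  have h : (fun t : ℝ => f (x + t • v)) =
      (fun y => f (x + y)) ∘ ContinuousLinearMap.toSpanSingleton ℝ v := by
    ext t; simp
  have hc : ContDiff ℝ n (fun y => f (x + y)) := hf.comp (contDiff_const.add contDiff_id)
  rw [iteratedDeriv_eq_iteratedFDeriv, h,
    ContinuousLinearMap.iteratedFDeriv_comp_right _ hc _ le_rfl, iteratedFDeriv_comp_add_left]
  simp

theorem iteratedDeriv_const_add_pow_smul_zero {F : Type*} [NormedAddCommGroup F]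
    [NormedSpace ℝ F] (a b : F) (k : ℕ) {l : ℕ} (hl : 1 ≤ l) :
    iteratedDeriv l (fun t : ℝ => a + t ^ k • b) 0 =
      if l = k then (k.factorial : ℝ) • b else 0 := by
  have hc : ContDiff ℝ l (fun t : ℝ => t ^ k) := contDiff_id.pow k
  rw [iteratedDeriv_const_add (by omega),
    iteratedDeriv_smul_const hc.contDiffAt, iteratedDeriv_fun_pow_zero]
  split_ifs <;> simp_all

/-- Theorem 4.3: for each `k ≥ 1` the right-hand side
`f(u) = (1, -u₁ᵏ u₃, u₁ᵏ u₂)` with `u₀ = (0,1,0)` in the semi inner product space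
`(ℝ³, ⟨·,·⟩_P)` with `P = diag(0,1,1)` satisfies `⟨u, f(u)⟩_P = 0` for all `u`,
`f(u₀) ≠ 0`, the `k`-th elementary differential `f⁽ᵏ⁾(f,…,f)` at `u₀` equals
`k!·(0,0,1)` (hence has positive seminorm and is `P`-orthogonal to `f(u₀)`), and all
other elementary differentials `f⁽ˡ⁾(f,…,f)`, `l ≥ 1`, `l ≠ k`, vanish at `u₀`. -/
theorem elementary_differentials_semi_inner_product (k : ℕ) (hk : 1 ≤ k)
    (f : (Fin 3 → ℝ) → (Fin 3 → ℝ))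
    (hf : f = fun u => ![1, -(u 0) ^ k * u 2, (u 0) ^ k * u 1])
    (u₀ : Fin 3 → ℝ) (hu₀ : u₀ = ![0, 1, 0]) :
    (∀ u : Fin 3 → ℝ, sipP u (f u) = 0) ∧
    f u₀ = ![1, 0, 0] ∧ f u₀ ≠ 0 ∧
    (∀ l : ℕ, 1 ≤ l →
      iteratedFDeriv ℝ l f u₀ (fun _ => f u₀)
        = if l = k then (k.factorial : ℝ) • ![0, 0, 1] else 0) ∧
    iteratedFDeriv ℝ k f u₀ (fun _ => f u₀) ≠ 0 ∧
    0 < sipP (iteratedFDeriv ℝ k f u₀ (fun _ => f u₀))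
          (iteratedFDeriv ℝ k f u₀ (fun _ => f u₀)) ∧
    sipP (f u₀) (iteratedFDeriv ℝ k f u₀ (fun _ => f u₀)) = 0 := by
  subst hf hu₀
  have hu : (fun u : Fin 3 → ℝ => ![1, -(u 0) ^ k * u 2, (u 0) ^ k * u 1]) ![0, 1, 0] =
      ![1, 0, 0] := by
    ext i; fin_cases i <;> simp [show k ≠ 0 by omega]
  have hc (l : ℕ) : ContDiff ℝ l
      (fun u : Fin 3 → ℝ => ![1, -(u 0) ^ k * u 2, (u 0) ^ k * u 1]) := by
    rw [contDiff_pi]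
    intro i; fin_cases i <;> simp <;> fun_prop
  have hD (l : ℕ) (hl : 1 ≤ l) :
      iteratedFDeriv ℝ l (fun u : Fin 3 → ℝ => ![1, -(u 0) ^ k * u 2, (u 0) ^ k * u 1])
        ![0, 1, 0] (fun _ => ![1, 0, 0]) =
        if l = k then (k.factorial : ℝ) • ![0, 0, 1] else 0 := by
    rw [iteratedFDeriv_const_apply_eq_iteratedDeriv (hc l),
      ← iteratedDeriv_const_add_pow_smul_zero ![1, 0, 0] ![0, 0, 1] k hl]
    congr 1
    ext t i; fin_cases i <;> simp
  rw [hu, hD k hk, if_pos rfl]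
  refine ⟨fun u => ?_, rfl, fun h => ?_, hD, fun h => ?_, ?_, ?_⟩
  · simp only [sipP, Matrix.cons_val]
    ring
  · simpa using congrFun h 0
  · simpa [k.factorial_ne_zero] using congrFun h 2
  · simp [sipP, k.factorial_ne_zero]
  · simp [sipP]
end

section
/- Let (A, b, c) be an explicit Butcher tableau with s ≥ 2 stages. Suppose there is an index i_max such that b_{i_max} ≠ 0 and |c_j| < |c_{i_max}| for every j ≠ i_max (a unique node of maximal absolute value). Then there exists k ∈ ℕ, k ≥ 1, such that Σ_{i,j=1}^s (b_i b_j − b_i a_{ij} − b_j a_{ji}) c_iᵏ c_jᵏ > 0, i.e. (bᵀcᵏ)² − 2(cᵏ)ᵀ diag(b) A cᵏ > 0, where the exponentiation cᵏ is componentwise. -/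
open Filter Topology in
/-- Powers of the entries of a vector, relative to an entry of strictly maximal absolute value,
converge to the corresponding standard basis vector. -/
lemma tendsto_div_pow_single {ι : Type*} [DecidableEq ι] {c : ι → ℝ} {m : ι} (hm : c m ≠ 0)
    (hc : ∀ j, j ≠ m → |c j| < |c m|) (i : ι) :
    Tendsto (fun k : ℕ => (c i / c m) ^ k) atTop (𝓝 ((Pi.single m 1 : ι → ℝ) i)) := by
  by_cases hi : i = m
  · subst hi
    simp [div_self hm]
  · rw [Pi.single_eq_of_ne hi]
    apply tendsto_pow_atTop_nhds_zero_of_abs_lt_one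
    rw [abs_div, div_lt_one (abs_pos.mpr hm)]
    exact hc i hi

open Filter Topology in
/-- The quadratic form of `M` is eventually positive on the powers of `c` if the diagonal entry of
`M` at the index where `|c|` is strictly maximal is positive. -/
lemma eventually_sum_mul_pow_mul_pow_pos {ι : Type*} [Fintype ι] {M : ι → ι → ℝ} {c : ι → ℝ}
    {m : ι} (hm : c m ≠ 0) (hc : ∀ j, j ≠ m → |c j| < |c m|) (hM : 0 < M m m) :
    ∀ᶠ k : ℕ in atTop, 0 < ∑ i, ∑ j, M i j * c i ^ k * c j ^ k := by
  classical
  have hlim : Tendsto (fun k : ℕ => ∑ i, ∑ j, M i j * (c i / c m) ^ k * (c j / c m) ^ k) atTop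
      (𝓝 (∑ i, ∑ j, M i j * (Pi.single m 1 : ι → ℝ) i * (Pi.single m 1 : ι → ℝ) j)) :=
    tendsto_finsetSum _ fun i _ => tendsto_finsetSum _ fun j _ =>
      (tendsto_const_nhds.mul (tendsto_div_pow_single hm hc i)).mul
        (tendsto_div_pow_single hm hc j)
  have hval : ∑ i, ∑ j, M i j * (Pi.single m 1 : ι → ℝ) i * (Pi.single m 1 : ι → ℝ) j = M m m := by
    simp [Pi.single_apply]
  rw [hval] at hlim
  filter_upwards [hlim.eventually_const_lt hM] with k hk
  have hscale : ∑ i, ∑ j, M i j * c i ^ k * c j ^ k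
      = (c m ^ k) ^ 2 * ∑ i, ∑ j, M i j * (c i / c m) ^ k * (c j / c m) ^ k := by
    simp only [Finset.mul_sum]
    refine Finset.sum_congr rfl fun i _ => Finset.sum_congr rfl fun j _ => ?_
    rw [div_pow, div_pow]
    field_simp
  rw [hscale]
  positivity

/-- Theorem 4.6: for an explicit Runge--Kutta method with a unique node of maximal
absolute value whose weight is nonzero, there is a `k ≥ 1` such that
`∑ (bᵢbⱼ - bᵢaᵢⱼ - bⱼaⱼᵢ) cᵢᵏ cⱼᵏ > 0`. -/
theorem positive_bushy_sum_of_unique_max_node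
    (s : ℕ) (hs : 2 ≤ s) (A : Fin s → Fin s → ℝ) (b c : Fin s → ℝ)
    (hexp : ∀ i j : Fin s, i ≤ j → A i j = 0)
    (imax : Fin s) (hbmax : b imax ≠ 0)
    (hcmax : ∀ j : Fin s, j ≠ imax → |c j| < |c imax|) :
    ∃ k : ℕ, 1 ≤ k ∧
      0 < ∑ i, ∑ j, (b i * b j - b i * A i j - b j * A j i) * c i ^ k * c j ^ k := by
  have : Nontrivial (Fin s) := Fin.nontrivial_iff_two_le.mpr hs
  obtain ⟨j, hj⟩ := exists_ne imax
  have hm : c imax ≠ 0 := abs_pos.mp ((abs_nonneg _).trans_lt (hcmax j hj))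
  have hM : 0 < b imax * b imax - b imax * A imax imax - b imax * A imax imax := by
    rw [hexp imax imax le_rfl]
    simpa using mul_self_pos.mpr hbmax
  exact ((Filter.eventually_ge_atTop 1).and (eventually_sum_mul_pow_mul_pow_pos
    (M := fun i j => b i * b j - b i * A i j - b j * A j i) hm hcmax hM)).exists
end

section
/- Consider the explicit 4-stage, second order accurate Runge–Kutta method with nodes c = (0, 1, 0, 1), weights b = (1/4, 1/4, 1/4, 1/4), and strictly lower triangular coefficient matrix A with rows (0,0,0,0), (1,0,0,0), (1,−1,0,0), (−1,1,1,0). Let H be a real Hilbert space and let f : H → H be analytic and semibounded, i.e. ⟨u, f(u)⟩ ≤ 0 for all u ∈ H. Then for every u₀ ∈ H there exists Δt_max > 0 such that for every Δt with 0 < Δt ≤ Δt_max, the Runge–Kutta step of size Δt from u₀ applied to u' = f(u) satisfies ‖u₊‖ ≤ ‖u₀‖. -/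
open scoped RealInnerProductSpace

/-- Energy balance of the four-stage method with stage derivatives `a`, `b`, `c`, `d`. -/
lemma norm_sq_four_stage_step {H : Type*} [NormedAddCommGroup H] [InnerProductSpace ℝ H]
    (h : ℝ) (u a b c d : H) :
    ‖u + (h / 4) • (a + b + c + d)‖ ^ 2 = ‖u‖ ^ 2
      + h / 2 * (⟪u, a⟫ + ⟪u + h • a, b⟫ + ⟪u + h • (a - b), c⟫ + ⟪u + h • (b + c - a), d⟫)
      + h ^ 2 / 16 * (3 * ‖(a - c) + (d - b)‖ ^ 2 - 2 * ‖a - d‖ ^ 2 - 2 * ‖b - c‖ ^ 2) := by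
  simp only [← real_inner_self_eq_norm_sq, inner_add_left, inner_add_right, inner_sub_left,
    inner_sub_right, real_inner_smul_left, real_inner_smul_right]
  rw [real_inner_comm a u, real_inner_comm b u, real_inner_comm c u, real_inner_comm d u,
    real_inner_comm b a, real_inner_comm c a, real_inner_comm d a, real_inner_comm c b,
    real_inner_comm d b, real_inner_comm d c]
  ring

/-- The quadratic remainder of the energy balance is nonpositive when `c` is close to `a` and
`d` is close to `b`, relative to the distance between `a` and `b`. -/
lemma four_stage_remainder_nonpos {H : Type*} [NormedAddCommGroup H] {a b c d : H}
    (hc : ‖c - a‖ ≤ ‖b - a‖ / 10) (hd : ‖d - b‖ ≤ ‖b - a‖ / 5) :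
    3 * ‖(a - c) + (d - b)‖ ^ 2 - 2 * ‖a - d‖ ^ 2 - 2 * ‖b - c‖ ^ 2 ≤ 0 := by
  have hsum : ‖(a - c) + (d - b)‖ ≤ 3 / 10 * ‖b - a‖ := by
    have := norm_add_le (a - c) (d - b)
    rw [norm_sub_rev a c] at this
    linarith
  have had : 4 / 5 * ‖b - a‖ ≤ ‖a - d‖ := by
    have := norm_sub_le_norm_sub_add_norm_sub b d a
    rw [norm_sub_rev b d, norm_sub_rev d a] at this
    linarith
  have hsum_sq := pow_le_pow_left₀ (norm_nonneg _) hsum 2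
  have had_sq := pow_le_pow_left₀ (by positivity) had 2
  nlinarith [sq_nonneg ‖b - a‖, sq_nonneg ‖b - c‖]

/-- If `f` is Lipschitz near `u`, the third and fourth stage derivatives are close to the first
and second one for small step sizes. -/
lemma four_stage_derivatives_close {H : Type*} [NormedAddCommGroup H] [NormedSpace ℝ H]
    {f : H → H} {u : H} {K r h : ℝ}
    (hK : 0 ≤ K) (hh : 0 < h) (hhK : h * K ≤ 1 / 10) (hr : h * ‖f u‖ < r / 2)
    (hf : ∀ x ∈ Metric.ball u r, ∀ y ∈ Metric.ball u r, ‖f x - f y‖ ≤ K * ‖x - y‖)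
    {v₂ v₃ v₄ : H} (h₂ : v₂ = u + h • f u) (h₃ : v₃ = u + h • (f u - f v₂))
    (h₄ : v₄ = u + h • (f v₂ + f v₃ - f u)) :
    ‖f v₃ - f u‖ ≤ ‖f v₂ - f u‖ / 10 ∧ ‖f v₄ - f v₂‖ ≤ ‖f v₂ - f u‖ / 5 := by
  have hN : 0 ≤ h * ‖f u‖ := by positivity
  have hu : u ∈ Metric.ball u r := Metric.mem_ball_self (by linarith)
  have e₂ : ‖v₂ - u‖ = h * ‖f u‖ := by
    rw [h₂, add_sub_cancel_left, norm_smul, Real.norm_of_nonneg hh.le]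
  have m₂ : v₂ ∈ Metric.ball u r := by
    rw [mem_ball_iff_norm, e₂]; linarith
  have l₂ : ‖f v₂ - f u‖ ≤ ‖f u‖ / 10 := by
    have := hf _ m₂ _ hu
    rw [e₂] at this
    nlinarith [norm_nonneg (f u)]
  have hG : h * ‖f v₂ - f u‖ ≤ h * ‖f u‖ / 10 := by
    nlinarith
  have e₃ : ‖v₃ - u‖ = h * ‖f v₂ - f u‖ := by
    rw [h₃, add_sub_cancel_left, norm_smul, Real.norm_of_nonneg hh.le, norm_sub_rev]
  have m₃ : v₃ ∈ Metric.ball u r := by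
    rw [mem_ball_iff_norm, e₃]; linarith
  have l₃ : ‖f v₃ - f u‖ ≤ ‖f v₂ - f u‖ / 10 := by
    have := hf _ m₃ _ hu
    rw [e₃] at this
    nlinarith [norm_nonneg (f v₂ - f u)]
  have e₄ : ‖v₄ - v₂‖ ≤ h * (11 / 10 * ‖f v₂ - f u‖) := by
    have : v₄ - v₂ = h • ((f v₂ - f u) + (f v₃ - f u)) := by
      linear_combination (norm := module) h₄ - h₂
    rw [this, norm_smul, Real.norm_of_nonneg hh.le]
    have := norm_add_le (f v₂ - f u) (f v₃ - f u)
    gcongr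
    linarith
  have m₄ : v₄ ∈ Metric.ball u r := by
    rw [mem_ball_iff_norm]
    have := norm_sub_le_norm_sub_add_norm_sub v₄ v₂ u
    linarith
  refine ⟨l₃, ?_⟩
  have := hf _ m₄ _ m₂
  have := mul_le_mul_of_nonneg_left e₄ hK
  nlinarith [norm_nonneg (f v₂ - f u)]



/-- Theorem 4.9: the explicit 4-stage, second order method with nodes `(0,1,0,1)`,
weights `(1/4,1/4,1/4,1/4)` and rows `(0,0,0,0), (1,0,0,0), (1,-1,0,0), (-1,1,1,0)`
is conditionally energy stable for autonomous ODEs `u' = f(u)` with analytic and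
semibounded right-hand side in a real Hilbert space. -/
theorem conditional_energy_stability_four_stage_method
    {H : Type*} [NormedAddCommGroup H] [InnerProductSpace ℝ H] [CompleteSpace H]
    (A : Fin 4 → Fin 4 → ℝ) (b : Fin 4 → ℝ)
    (hA : A = !![0, 0, 0, 0; 1, 0, 0, 0; 1, -1, 0, 0; -1, 1, 1, 0])
    (hb : b = ![1 / 4, 1 / 4, 1 / 4, 1 / 4])
    (f : H → H) (hf : ∀ x : H, AnalyticAt ℝ f x)
    (hsemi : ∀ u : H, ⟪u, f u⟫ ≤ 0)
    (u₀ : H) :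
    ∃ Δtmax > (0 : ℝ), ∀ Δt : ℝ, 0 < Δt → Δt ≤ Δtmax →
      ∀ u : Fin 4 → H,
        (∀ i, u i = u₀ + Δt • ∑ j, A i j • f (u j)) →
        ‖u₀ + Δt • ∑ i, b i • f (u i)‖ ≤ ‖u₀‖ := by
  subst hA hb
  obtain ⟨K, t, ht, hLip⟩ := ((hf u₀).contDiffAt (n := 1)).exists_lipschitzOnWith
  obtain ⟨r, hr, hrt⟩ := Metric.mem_nhds_iff.mp ht
  have hK : (0 : ℝ) ≤ K := K.coe_nonneg
  have hN := norm_nonneg (f u₀)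
  refine ⟨min (1 / (10 * (K + 1))) (r / (4 * (‖f u₀‖ + 1))), by positivity, ?_⟩
  intro h hh hle u hu
  have hhK : h * K ≤ 1 / 10 := by
    have := (le_div_iff₀ (by positivity)).mp (hle.trans (min_le_left _ _))
    linarith
  have hhr : h * ‖f u₀‖ < r / 2 := by
    have := (le_div_iff₀ (by positivity)).mp (hle.trans (min_le_right _ _))
    linarith
  have h₁ : u 0 = u₀ := by simpa [Fin.sum_univ_four] using hu 0
  have h₂ : u 1 = u₀ + h • f u₀ := by simpa [Fin.sum_univ_four, h₁] using hu 1
  have h₃ : u 2 = u₀ + h • (f u₀ - f (u 1)) := by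
    simpa [Fin.sum_univ_four, h₁, ← sub_eq_add_neg] using hu 2
  have h₄ : u 3 = u₀ + h • (f (u 1) + f (u 2) - f u₀) := by
    rw [hu 3]
    simp [Fin.sum_univ_four, h₁]
    module
  obtain ⟨hc, hd⟩ := four_stage_derivatives_close hK hh hhK hhr
    (fun x hx y hy => hLip.norm_sub_le (hrt hx) (hrt hy)) h₂ h₃ h₄
  have hrem := four_stage_remainder_nonpos hc hd
  have hstep : u₀ + h • ∑ i, (![1 / 4, 1 / 4, 1 / 4, 1 / 4] : Fin 4 → ℝ) i • f (u i)
      = u₀ + (h / 4) • (f u₀ + f (u 1) + f (u 2) + f (u 3)) := by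
    simp [Fin.sum_univ_four, h₁]
    module
  rw [hstep]
  refine (sq_le_sq₀ (norm_nonneg _) (norm_nonneg _)).mp ?_
  rw [norm_sq_four_stage_step, ← h₂, ← h₃, ← h₄]
  have hdiss := mul_nonpos_of_nonneg_of_nonpos (by positivity : 0 ≤ h / 2)
    (add_nonpos (add_nonpos (add_nonpos (hsemi u₀) (hsemi (u 1))) (hsemi (u 2))) (hsemi (u 3)))
  have hquad := mul_nonpos_of_nonneg_of_nonpos (by positivity : 0 ≤ h ^ 2 / 16) hrem
  linarith
end

section
/- Let (A, b, c) be an explicit Butcher tableau with s stages that is at least second order accurate (Σ_{i=1}^s b_i = 1 and Σ_{i=1}^s b_i c_i = 1/2) and satisfies: (i) b_i ≥ 0 for all i; (ii) b_j − Σ_{i=1}^s b_i a_{ij} − b_j c_j = 0 for all j; (iii) c_i = Σ_{j=1}^s a_{ij} for all i; (iv) Σ_{i,j=1}^s (b_i b_j − b_i a_{ij} − b_j a_{ji}) c_iᵏ c_jᵏ < 0 for every k ∈ ℕ with k ≥ 1. Then the method is conditionally energy stable for autonomous semibounded analytic problems: for every real Hilbert space H, every analytic f : H → H with ⟨u, f(u)⟩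 ≤ 0 for all u ∈ H, and every u₀ ∈ H, there exists Δt_max > 0 such that for all Δt with 0 < Δt ≤ Δt_max the Runge–Kutta step of size Δt from u₀ applied to u' = f(u) satisfies ‖u₊‖ ≤ ‖u₀‖. -/
open scoped RealInnerProductSpace
open Filter Topology Asymptotics

section RungeKutta

variable {s : ℕ} {H : Type*} [NormedAddCommGroup H] [InnerProductSpace ℝ H]

/-- Energy balance of a Runge--Kutta step, for arbitrary vectors `F i` in place of `f (u i)`. -/
theorem norm_sq_rungeKutta_step (A : Fin s → Fin s → ℝ) (b : Fin s → ℝ) (u₀ : H) (t : ℝ)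
    (u F : Fin s → H) (hu : ∀ i, u i = u₀ + t • ∑ j, A i j • F j) :
    ‖u₀ + t • ∑ i, b i • F i‖ ^ 2 = ‖u₀‖ ^ 2 + 2 * t * ∑ i, b i * ⟪u i, F i⟫ +
      t ^ 2 * ∑ i, ∑ j, (b i * b j - b i * A i j - b j * A j i) * ⟪F i, F j⟫ := by
  have hstage : ∑ i, b i * ⟪u i, F i⟫ =
      ∑ i, b i * ⟪u₀, F i⟫ + t * ∑ i, ∑ j, b i * A i j * ⟪F i, F j⟫ := by
    rw [Finset.mul_sum, ← Finset.sum_add_distrib]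
    refine Finset.sum_congr rfl fun i _ => ?_
    rw [hu i, inner_add_left, real_inner_smul_left, sum_inner, mul_add, Finset.mul_sum,
      Finset.mul_sum, Finset.mul_sum]
    congr 1
    refine Finset.sum_congr rfl fun j _ => ?_
    rw [real_inner_smul_left, real_inner_comm]
    ring
  have hswap : ∑ i, ∑ j, b j * A j i * ⟪F i, F j⟫ = ∑ i, ∑ j, b i * A i j * ⟪F i, F j⟫ := by
    rw [Finset.sum_comm]
    simp only [real_inner_comm]
  have hquad : ‖∑ i, b i • F i‖ ^ 2 = ∑ i, ∑ j, b i * b j * ⟪F i, F j⟫ := by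
    rw [← real_inner_self_eq_norm_sq, sum_inner]
    refine Finset.sum_congr rfl fun i _ => ?_
    rw [inner_sum]
    refine Finset.sum_congr rfl fun j _ => ?_
    rw [real_inner_smul_left, real_inner_smul_right]
    ring
  have hlin : ⟪u₀, ∑ i, b i • F i⟫ = ∑ i, b i * ⟪u₀, F i⟫ := by
    simp only [inner_sum, real_inner_smul_right]
  rw [norm_add_sq_real, real_inner_smul_right, norm_smul, mul_pow, hquad, hlin, hstage]
  simp only [sub_mul, Finset.sum_sub_distrib, hswap, Real.norm_eq_abs, sq_abs]
  ring

/-- A symmetric quadratic form whose row sums vanish is unchanged by subtracting a constant. -/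
theorem sum_mul_inner_sub_const (M : Fin s → Fin s → ℝ) (hsymm : ∀ i j, M i j = M j i)
    (hM : ∀ i, ∑ j, M i j = 0) (F : Fin s → H) (w : H) :
    ∑ i, ∑ j, M i j * ⟪F i - w, F j - w⟫ = ∑ i, ∑ j, M i j * ⟪F i, F j⟫ := by
  have hrow (x : Fin s → ℝ) : ∑ i, ∑ j, M i j * x i = 0 := by
    simp only [← Finset.sum_mul, hM, zero_mul, Finset.sum_const_zero]
  have hcol (x : Fin s → ℝ) : ∑ i, ∑ j, M i j * x j = 0 := by
    rw [Finset.sum_comm]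
    simpa only [hsymm] using hrow x
  simp only [inner_sub_left, inner_sub_right, mul_sub, Finset.sum_sub_distrib,
    hrow fun i => ⟪F i, w⟫, hcol fun j => ⟪w, F j⟫, hrow fun _ => ⟪w, w⟫, sub_zero]

/-- Pairs of a step size tending to `0` from above and stage values for that step size. -/
def stageFilter (A : Fin s → Fin s → ℝ) (f : H → H) (u₀ : H) : Filter (ℝ × (Fin s → H)) :=
  comap Prod.fst (𝓝[>] 0) ⊓ 𝓟 {p | ∀ i, p.2 i = u₀ + p.1 • ∑ j, A i j • f (p.2 j)}

theorem tendsto_fst_stageFilter (A : Fin s → Fin s → ℝ) (f : H → H) (u₀ : H) :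
    Tendsto Prod.fst (stageFilter A f u₀) (𝓝[>] 0) :=
  tendsto_comap.mono_left inf_le_left

theorem eventually_stageFilter (A : Fin s → Fin s → ℝ) (f : H → H) (u₀ : H) :
    ∀ᶠ p in stageFilter A f u₀, ∀ i, p.2 i = u₀ + p.1 • ∑ j, A i j • f (p.2 j) :=
  mem_inf_of_right (mem_principal_self _)

theorem exists_stepSize_of_eventually_stageFilter {A : Fin s → Fin s → ℝ} {f : H → H} {u₀ : H}
    {P : ℝ × (Fin s → H) → Prop} (h : ∀ᶠ p in stageFilter A f u₀, P p) :
    ∃ tmax > (0 : ℝ), ∀ t, 0 < t → t ≤ tmax → ∀ u : Fin s → H,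
      (∀ i, u i = u₀ + t • ∑ j, A i j • f (u j)) → P (t, u) := by
  rw [stageFilter, eventually_inf_principal, eventually_comap] at h
  obtain ⟨tmax, hpos, hsub⟩ := mem_nhdsGT_iff_exists_Ioc_subset.1 h
  exact ⟨tmax, hpos, fun t ht hle u hu => hsub ⟨ht, hle⟩ (t, u) rfl hu⟩

theorem sum_smul_eq_smul_add_sum_smul_sub {A : Fin s → Fin s → ℝ} {c : Fin s → ℝ}
    (hrow : ∀ i, c i = ∑ j, A i j) (F : Fin s → H) (w : H) (i : Fin s) :
    ∑ j, A i j • F j = c i • w + ∑ j, A i j • (F j - w) := by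
  rw [hrow i, Finset.sum_smul, ← Finset.sum_add_distrib]
  exact Finset.sum_congr rfl fun j _ => by rw [← smul_add, add_sub_cancel]

variable {A : Fin s → Fin s → ℝ} {c : Fin s → ℝ} {f : H → H} {u₀ : H}

theorem tendsto_mul_fst_stageFilter (r : ℝ) :
    Tendsto (fun p => r * p.1) (stageFilter A f u₀) (𝓝 0) := by
  simpa using ((tendsto_fst_stageFilter A f u₀).mono_right nhdsWithin_le_nhds).const_mul r

/-- If `f` is constant along the ray from `u₀` in direction `f u₀`, all stage slopes agree. -/
theorem eventually_slope_eq_of_eventually_eq (hexp : ∀ i j, i ≤ j → A i j = 0)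
    (hrow : ∀ i, c i = ∑ j, A i j)
    (hf : ∀ᶠ z : ℝ in 𝓝 0, f (u₀ + z • f u₀) = f u₀) (i : Fin s) :
    ∀ᶠ p in stageFilter A f u₀, f (p.2 i) = f u₀ := by
  induction i using WellFoundedLT.induction with
  | ind i ih =>
  have hearlier : ∀ᶠ p in stageFilter A f u₀, ∀ j, j < i → f (p.2 j) = f u₀ := by
    refine eventually_all.2 fun j => ?_
    by_cases hj : j < i
    · filter_upwards [ih j hj] with p hp _ using hp
    · exact Eventually.of_forall fun p h => absurd h hj
  filter_upwards [hearlier, eventually_stageFilter A f u₀,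
    (tendsto_mul_fst_stageFilter (c i)).eventually hf] with p hp hu hray
  have hzero : ∑ j, A i j • (f (p.2 j) - f u₀) = 0 := by
    refine Finset.sum_eq_zero fun j _ => ?_
    rcases lt_or_ge j i with hj | hj
    · rw [hp j hj, sub_self, smul_zero]
    · rw [hexp i j hj, zero_smul]
  rw [hu i, sum_smul_eq_smul_add_sum_smul_sub hrow _ (f u₀), hzero, add_zero, smul_smul, mul_comm]
  exact hray

/-- If `f (u₀ + z • f u₀) - f u₀ = z ^ n • g z`, the stage slopes satisfy
`f (u i) = f u₀ + (c i * t) ^ n • g 0 + o(t ^ n)`. -/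
theorem tendsto_slope_sub_of_eventually_eq (hexp : ∀ i j, i ≤ j → A i j = 0)
    (hrow : ∀ i, c i = ∑ j, A i j) {f' : H →L[ℝ] H} (hf : HasStrictFDerivAt f f' u₀)
    {n : ℕ} {g : ℝ → H} (hg : ContinuousAt g 0)
    (hfg : ∀ᶠ z : ℝ in 𝓝 0, f (u₀ + z • f u₀) - f u₀ = z ^ n • g z) (i : Fin s) :
    Tendsto (fun p => (p.1 ^ n)⁻¹ • (f (p.2 i) - f u₀)) (stageFilter A f u₀)
      (𝓝 (c i ^ n • g 0)) := by
  induction i using WellFoundedLT.induction with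
  | ind i ih =>
  set l := stageFilter A f u₀ with hl
  have ht : Tendsto (fun p : ℝ × (Fin s → H) => p.1) l (𝓝 0) := by
    simpa using tendsto_mul_fst_stageFilter (A := A) (f := f) (u₀ := u₀) 1
  have hne : ∀ᶠ p in l, p.1 ≠ 0 :=
    ((tendsto_fst_stageFilter A f u₀).eventually eventually_mem_nhdsWithin).mono
      fun p (hp : 0 < p.1) => hp.ne'
  set S : ℝ × (Fin s → H) → H := fun p => ∑ j, A i j • (f (p.2 j) - f u₀) with hS
  set v : ℝ × (Fin s → H) → H := fun p => u₀ + (c i * p.1) • f u₀ with hv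
  have hstage : ∀ᶠ p in l, p.2 i = v p + p.1 • S p := by
    filter_upwards [eventually_stageFilter A f u₀] with p hu
    rw [hu i, sum_smul_eq_smul_add_sum_smul_sub hrow _ (f u₀), smul_add, smul_smul,
      mul_comm, ← add_assoc]
  obtain ⟨L, hL⟩ : ∃ L, Tendsto (fun p => (p.1 ^ n)⁻¹ • S p) l (𝓝 L) := by
    refine ⟨∑ j, A i j • c j ^ n • g 0, ?_⟩
    simp only [hS, Finset.smul_sum]
    refine tendsto_finsetSum _ fun j _ => ?_
    rcases lt_or_ge j i with hj | hj
    · simpa only [smul_comm _ (A i j)] using (ih j hj).const_smul (A i j)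
    · simpa only [hexp i j hj, zero_smul, smul_zero] using tendsto_const_nhds
  have hdiff : Tendsto (fun p => (p.1 ^ n)⁻¹ • (p.1 • S p)) l (𝓝 0) := by
    have h := ht.smul hL
    rw [zero_smul] at h
    exact h.congr fun p => smul_comm _ _ _
  have hv0 : Tendsto v l (𝓝 u₀) := by
    simpa using ((tendsto_mul_fst_stageFilter (c i)).smul_const (f u₀)).const_add u₀
  have hdiff0 : Tendsto (fun p => p.1 • S p) l (𝓝 0) := by
    have h := (ht.pow n).smul hdiff
    rw [smul_zero] at h
    refine h.congr' ?_
    filter_upwards [hne] with p hp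
    rw [smul_inv_smul₀ (pow_ne_zero n hp)]
  have hu0 : Tendsto (fun p : ℝ × (Fin s → H) => p.2 i) l (𝓝 u₀) := by
    refine Tendsto.congr' (EventuallyEq.symm hstage) ?_
    simpa using hv0.add hdiff0
  have hlip : (fun p : ℝ × (Fin s → H) => f (p.2 i) - f (v p)) =O[l] fun p => p.1 • S p := by
    refine (hf.isBigO_sub.comp_tendsto (hu0.prodMk_nhds hv0)).congr' EventuallyEq.rfl ?_
    filter_upwards [hstage] with p hp
    simp [hp]
  have herr : Tendsto (fun p => (p.1 ^ n)⁻¹ • (f (p.2 i) - f (v p))) l (𝓝 0) :=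
    ((isBigO_refl (fun p : ℝ × (Fin s → H) => (p.1 ^ n)⁻¹) l).smul hlip).trans_tendsto hdiff
  have hmain : Tendsto (fun p => (p.1 ^ n)⁻¹ • (f (v p) - f u₀)) l (𝓝 (c i ^ n • g 0)) := by
    refine Tendsto.congr' ?_ ((hg.tendsto.comp (tendsto_mul_fst_stageFilter (c i))).const_smul _)
    filter_upwards [hne, (tendsto_mul_fst_stageFilter (c i)).eventually hfg] with p hp hray
    rw [hv, hray, smul_smul, mul_pow, mul_comm, mul_assoc, mul_inv_cancel₀ (pow_ne_zero n hp),
      mul_one, Function.comp_apply]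
  have hadd := herr.add hmain
  rw [zero_add] at hadd
  refine hadd.congr fun p => ?_
  rw [← smul_add, sub_add_sub_cancel]

/-- The quadratic part of the energy balance is eventually nonpositive. -/
theorem eventually_quadratic_nonpos [CompleteSpace H] (hexp : ∀ i j, i ≤ j → A i j = 0)
    (hrow : ∀ i, c i = ∑ j, A i j) {M : Fin s → Fin s → ℝ} (hsymm : ∀ i j, M i j = M j i)
    (hM : ∀ i, ∑ j, M i j = 0)
    (hneg : ∀ k : ℕ, 1 ≤ k → ∑ i, ∑ j, M i j * c i ^ k * c j ^ k < 0)
    (hf : AnalyticAt ℝ f u₀) :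
    ∀ᶠ p in stageFilter A f u₀, ∑ i, ∑ j, M i j * ⟪f (p.2 i), f (p.2 j)⟫ ≤ 0 := by
  have hray : AnalyticAt ℝ (fun z : ℝ => f (u₀ + z • f u₀) - f u₀) 0 := by
    refine AnalyticAt.sub (AnalyticAt.fun_comp (by simpa using hf) ?_) analyticAt_const
    fun_prop
  by_cases hconst : ∀ᶠ z : ℝ in 𝓝 0, f (u₀ + z • f u₀) - f u₀ = 0
  · filter_upwards [eventually_all.2 (eventually_slope_eq_of_eventually_eq hexp hrow
      (hconst.mono fun z => sub_eq_zero.1))] with p hp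
    simp only [hp, ← Finset.sum_mul, hM, zero_mul, Finset.sum_const_zero, le_refl]
  obtain ⟨n, g, hg, hg0, hfg⟩ := hray.exists_eventuallyEq_pow_smul_nonzero_iff.2 hconst
  simp only [sub_zero] at hfg
  have hn : 1 ≤ n := by
    rw [Nat.one_le_iff_ne_zero]
    rintro rfl
    have := hfg.self_of_nhds
    simp only [zero_smul, add_zero, sub_self, pow_zero, one_smul] at this
    exact hg0 this.symm
  have hlim := tendsto_slope_sub_of_eventually_eq hexp hrow hf.hasStrictFDerivAt
    hg.continuousAt hfg
  have hquad := tendsto_finsetSum Finset.univ fun i _ => tendsto_finsetSum Finset.univ fun j _ =>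
    ((hlim i).inner (𝕜 := ℝ) (hlim j)).const_mul (M i j)
  have hlimneg : ∑ i, ∑ j, M i j * ⟪c i ^ n • g 0, c j ^ n • g 0⟫ < 0 := by
    have : ∑ i, ∑ j, M i j * ⟪c i ^ n • g 0, c j ^ n • g 0⟫ =
        (∑ i, ∑ j, M i j * c i ^ n * c j ^ n) * ‖g 0‖ ^ 2 := by
      simp only [Finset.sum_mul, real_inner_smul_left, real_inner_smul_right,
        real_inner_self_eq_norm_sq]
      refine Finset.sum_congr rfl fun i _ => Finset.sum_congr rfl fun j _ => ?_
      ring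
    rw [this]
    exact mul_neg_of_neg_of_pos (hneg n hn) (by positivity)
  filter_upwards [hquad.eventually_lt_const hlimneg,
    (tendsto_fst_stageFilter A f u₀).eventually eventually_mem_nhdsWithin] with p hp hpos
  have hpos : 0 < (p.1 ^ n)⁻¹ := inv_pos.2 (pow_pos hpos n)
  have hscale : ∑ i, ∑ j,
      M i j * ⟪(p.1 ^ n)⁻¹ • (f (p.2 i) - f u₀), (p.1 ^ n)⁻¹ • (f (p.2 j) - f u₀)⟫ =
      ((p.1 ^ n)⁻¹) ^ 2 * ∑ i, ∑ j, M i j * ⟪f (p.2 i), f (p.2 j)⟫ := by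
    rw [← sum_mul_inner_sub_const M hsymm hM (fun i => f (p.2 i)) (f u₀)]
    simp only [Finset.mul_sum, real_inner_smul_left, real_inner_smul_right]
    refine Finset.sum_congr rfl fun i _ => Finset.sum_congr rfl fun j _ => ?_
    ring
  rw [hscale] at hp
  exact (neg_of_mul_neg_right hp (sq_nonneg _)).le

end RungeKutta

/-- Proposition 4.10: an explicit, at least second order accurate Runge--Kutta method with
nonnegative weights satisfying `bⱼ - ∑ᵢ bᵢaᵢⱼ - bⱼcⱼ = 0`, `cᵢ = ∑ⱼ aᵢⱼ`, and
`∑ (bᵢbⱼ - bᵢaᵢⱼ - bⱼaⱼᵢ) cᵢᵏ cⱼᵏ < 0` for all `k ≥ 1`, is conditionally energy stable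
for autonomous ODEs with analytic, semibounded right-hand side in any real Hilbert
space. -/
theorem conditional_energy_stability_criterion
    (s : ℕ) (A : Fin s → Fin s → ℝ) (b c : Fin s → ℝ)
    (hexp : ∀ i j : Fin s, i ≤ j → A i j = 0)
    (horder1 : ∑ i, b i = 1)
    (horder2 : ∑ i, b i * c i = 1 / 2)
    (hbnonneg : ∀ i, 0 ≤ b i)
    (hcolumn : ∀ j, b j - (∑ i, b i * A i j) - b j * c j = 0)
    (hrow : ∀ i, c i = ∑ j, A i j)
    (hsum : ∀ k : ℕ, 1 ≤ k →
      ∑ i, ∑ j, (b i * b j - b i * A i j - b j * A j i) * c i ^ k * c j ^ k < 0)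
    {H : Type*} [NormedAddCommGroup H] [InnerProductSpace ℝ H] [CompleteSpace H]
    (f : H → H) (hf : ∀ x : H, AnalyticAt ℝ f x)
    (hsemi : ∀ u : H, ⟪u, f u⟫ ≤ 0)
    (u₀ : H) :
    ∃ Δtmax > (0 : ℝ), ∀ Δt : ℝ, 0 < Δt → Δt ≤ Δtmax →
      ∀ u : Fin s → H,
        (∀ i, u i = u₀ + Δt • ∑ j, A i j • f (u j)) →
        ‖u₀ + Δt • ∑ i, b i • f (u i)‖ ≤ ‖u₀‖ := by
  set M : Fin s → Fin s → ℝ := fun i j => b i * b j - b i * A i j - b j * A j i with hMdef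
  have hsymm (i j) : M i j = M j i := by simp only [hMdef]; ring
  have hM (i) : ∑ j, M i j = 0 := by
    simp only [hMdef, Finset.sum_sub_distrib, ← Finset.mul_sum, horder1, ← hrow]
    linarith [hcolumn i]
  obtain ⟨tmax, hpos, hstep⟩ := exists_stepSize_of_eventually_stageFilter
    (eventually_quadratic_nonpos hexp hrow hsymm hM hsum (hf u₀))
  refine ⟨tmax, hpos, fun t ht hle u hu => ?_⟩
  refine (sq_le_sq₀ (norm_nonneg _) (norm_nonneg _)).1 ?_
  rw [norm_sq_rungeKutta_step A b u₀ t u (fun i => f (u i)) hu]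
  have hlin : ∑ i, b i * ⟪u i, f (u i)⟫ ≤ 0 :=
    Finset.sum_nonpos fun i _ => mul_nonpos_of_nonneg_of_nonpos (hbnonneg i) (hsemi _)
  have hquad := hstep t ht hle u hu
  linarith [mul_nonpos_of_nonneg_of_nonpos (by positivity : 0 ≤ 2 * t) hlin,
    mul_nonpos_of_nonneg_of_nonpos (sq_nonneg t) hquad]
end

section
/- Consider the explicit 5-stage, third order Runge–Kutta method with nodes c = (0, 1/2, 1, 0, 1), weights b = (0, 2/3, 0, 1/6, 1/6), and strictly lower triangular coefficient matrix A with rows (0,0,0,0,0), (1/2,0,0,0,0), (1,0,0,0,0), (1,0,−1,0,0), (−3,2,1,1,0). Then for every k ∈ ℕ with k ≥ 1, Σ_{i,j=1}^5 (b_i b_j − b_i a_{ij} − b_j a_{ji}) c_iᵏ c_jᵏ = −11/36 − (4/9)·2^{−k}(1 − 2^{−k}), which is strictly negative. -/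
/-- Corollary 4.13 computation: for the explicit 5-stage, third order method with nodes
`(0,1/2,1,0,1)`, weights `(0,2/3,0,1/6,1/6)` and rows `(0,0,0,0,0), (1/2,0,0,0,0),
(1,0,0,0,0), (1,0,-1,0,0), (-3,2,1,1,0)`, the sum
`∑ (bᵢbⱼ - bᵢaᵢⱼ - bⱼaⱼᵢ) cᵢᵏ cⱼᵏ` equals `-11/36 - (4/9)·2⁻ᵏ(1 - 2⁻ᵏ)` for every
`k ≥ 1`, which is strictly negative. -/
theorem bushy_sum_five_stage_method (k : ℕ) (hk : 1 ≤ k)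
    (A : Fin 5 → Fin 5 → ℝ) (b c : Fin 5 → ℝ)
    (hA : A = !![0, 0, 0, 0, 0; 1 / 2, 0, 0, 0, 0; 1, 0, 0, 0, 0;
                 1, 0, -1, 0, 0; -3, 2, 1, 1, 0])
    (hb : b = ![0, 2 / 3, 0, 1 / 6, 1 / 6])
    (hc : c = ![0, 1 / 2, 1, 0, 1]) :
    ∑ i, ∑ j, (b i * b j - b i * A i j - b j * A j i) * c i ^ k * c j ^ k
      = -(11 / 36) - (4 / 9) * ((2 : ℝ) ^ k)⁻¹ * (1 - ((2 : ℝ) ^ k)⁻¹) ∧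
    -(11 / 36) - (4 / 9) * ((2 : ℝ) ^ k)⁻¹ * (1 - ((2 : ℝ) ^ k)⁻¹) < 0 := by
  have hk0 : k ≠ 0 := by omega
  have ht_pos : (0 : ℝ) < ((2 : ℝ) ^ k)⁻¹ := by positivity
  have ht_le : ((2 : ℝ) ^ k)⁻¹ ≤ 1 := inv_le_one_of_one_le₀ (one_le_pow₀ one_le_two)
  constructor
  · subst hA hb hc
    simp [Fin.sum_univ_five, hk0]
    ring
  · nlinarith [mul_nonneg ht_pos.le (sub_nonneg.2 ht_le)]
end

section
/- Consider the explicit 5-stage, third order Runge–Kutta method with nodes c = (0, 1/2, 1, 0, 1), weights b = (0, 2/3, 0, 1/6, 1/6), and strictly lower triangular coefficient matrix A with rows (0,0,0,0,0), (1/2,0,0,0,0), (1,0,0,0,0), (1,0,−1,0,0), (−3,2,1,1,0). Let H be a real Hilbert space and let f : H → H be analytic and semibounded, i.e. ⟨u, f(u)⟩ ≤ 0 for all u ∈ H. Then for every u₀ ∈ H there exists Δt_max > 0 such that for every Δt with 0 < Δt ≤ Δt_max, the Runge–Kutta step of size Δt from u₀ applied to u' = f(u) satisfies ‖u₊‖ ≤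 ‖u₀‖. -/
open scoped RealInnerProductSpace Topology

/-- Near a point of analyticity, the increment over a half step deviates from half of the full
increment by at most three quarters of the latter. -/
lemma AnalyticAt.eventually_norm_two_smul_half_sub_le {E : Type*} [NormedAddCommGroup E]
    [NormedSpace ℝ E] {g : ℝ → E} (hg : AnalyticAt ℝ g 0) :
    ∀ᶠ t in 𝓝 (0 : ℝ),
      ‖(2 : ℝ) • (g (t / 2) - g 0) - (g t - g 0)‖ ≤ 3 / 2 * ‖g t - g 0‖ := by
  have half : Filter.Tendsto (fun t : ℝ => t / 2) (𝓝 0) (𝓝 0) := by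
    simpa using (continuous_id.div_const (2 : ℝ)).tendsto 0
  by_cases hconst : ∀ᶠ t in 𝓝 (0 : ℝ), g t - g 0 = 0
  · filter_upwards [hconst, half.eventually hconst] with t h₁ h₂
    simp [h₁, h₂]
  have han : AnalyticAt ℝ (fun t => g t - g 0) 0 := hg.sub analyticAt_const
  obtain ⟨n, w, hw, hw0, hgw⟩ := han.exists_eventuallyEq_pow_smul_nonzero_iff.mpr hconst
  simp only [sub_zero] at hgw
  obtain ⟨m, rfl⟩ : ∃ m, n = m + 1 := by
    refine Nat.exists_eq_succ_of_ne_zero fun hn => hw0 ?_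
    have := hgw.self_of_nhds
    simpa [hn] using this.symm
  have hwc : Filter.Tendsto w (𝓝 0) (𝓝 (w 0)) := hw.continuousAt
  have hlim : Filter.Tendsto (fun t => ‖((1 / 2 : ℝ) ^ m) • w (t / 2) - w t‖) (𝓝 0)
      (𝓝 ‖((1 / 2 : ℝ) ^ m) • w 0 - w 0‖) :=
    (((hwc.comp half).const_smul _).sub hwc).norm
  have hlt : ‖((1 / 2 : ℝ) ^ m) • w 0 - w 0‖ < 3 / 2 * ‖w 0‖ := by
    have h0 : (0 : ℝ) ≤ (1 / 2) ^ m := by positivity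
    have h1 : ((1 : ℝ) / 2) ^ m ≤ 1 := pow_le_one₀ (by norm_num) (by norm_num)
    have hpos := norm_pos_iff.mpr hw0
    have hsplit : ((1 / 2 : ℝ) ^ m) • w 0 - w 0 = ((1 / 2 : ℝ) ^ m - 1) • w 0 := by
      rw [sub_smul, one_smul]
    rw [hsplit, norm_smul]
    have : ‖(1 / 2 : ℝ) ^ m - 1‖ ≤ 1 := by
      rw [Real.norm_eq_abs, abs_le]; constructor <;> linarith
    nlinarith
  filter_upwards [hgw, half.eventually hgw, hlim.eventually_lt (hwc.norm.const_mul _) hlt]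
    with t h₁ h₂ h₃
  have hfac : (2 : ℝ) • (t / 2) ^ (m + 1) • w (t / 2) - t ^ (m + 1) • w t
      = t ^ (m + 1) • (((1 / 2 : ℝ) ^ m) • w (t / 2) - w t) := by
    rw [smul_sub, smul_smul, smul_smul]
    congr 2
    rw [div_pow, div_pow, pow_succ 2 m]
    field_simp
    simp
  rw [h₁, h₂, hfac, norm_smul, norm_smul]
  nlinarith [norm_nonneg (t ^ (m + 1))]

/-- Negativity of the quadratic form that governs the energy change, for perturbations dominated
by `q`. -/
lemma energy_quadratic_form_nonpos {H : Type*} [NormedAddCommGroup H] [InnerProductSpace ℝ H]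
    {p q r e : H} (hp : ‖p‖ ≤ 3 / 2 * ‖q‖) (hr : ‖r‖ ≤ 1 / 10 * ‖q‖)
    (he : ‖e‖ ≤ 1 / 10 * ‖q‖) :
    4 * ⟪p, p⟫ - 15 * ⟪q, q⟫ + ⟪e, e⟫ + ⟪r, r⟫ - 8 * ⟪p, e⟫ - 18 * ⟪q, e⟫ + 4 * ⟪p, r⟫
      + 6 * ⟪q, r⟫ - 10 * ⟪r, e⟫ ≤ 0 := by
  have bound : ∀ {x y : H} {s t : ℝ}, 0 ≤ s → ‖x‖ ≤ s * ‖q‖ → ‖y‖ ≤ t * ‖q‖ →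
      |⟪x, y⟫| ≤ s * t * ‖q‖ ^ 2 := fun {x y s t} hs hx hy =>
    calc |⟪x, y⟫| ≤ ‖x‖ * ‖y‖ := abs_real_inner_le_norm x y
      _ ≤ (s * ‖q‖) * (t * ‖q‖) := by gcongr
      _ = s * t * ‖q‖ ^ 2 := by ring
  have hq : ‖q‖ ≤ 1 * ‖q‖ := by simp
  have hqq := real_inner_self_eq_norm_sq q
  have h₁ := abs_le.mp (bound (by norm_num) hp hp)
  have h₂ := abs_le.mp (bound (by norm_num) he he)
  have h₃ := abs_le.mp (bound (by norm_num) hr hr)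
  have h₄ := abs_le.mp (bound (by norm_num) hp he)
  have h₅ := abs_le.mp (bound (by norm_num) hq he)
  have h₆ := abs_le.mp (bound (by norm_num) hp hr)
  have h₇ := abs_le.mp (bound (by norm_num) hq hr)
  have h₈ := abs_le.mp (bound (by norm_num) hr he)
  linarith [sq_nonneg ‖q‖, h₁.2, h₂.2, h₃.2, h₄.1, h₅.1, h₆.2, h₇.2, h₈.1]

/-- The energy estimate for one step, in terms of the stage slopes `k₁, …, k₅`. -/
lemma norm_step_le_of_slope_bounds {H : Type*} [NormedAddCommGroup H] [InnerProductSpace ℝ H]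
    {h : ℝ} (hh : 0 ≤ h) {u₀ k₁ k₂ k₃ k₄ k₅ : H}
    (h₂ : ⟪u₀ + h • (1 / 2 : ℝ) • k₁, k₂⟫ ≤ 0)
    (h₄ : ⟪u₀ + h • (k₁ - k₃), k₄⟫ ≤ 0)
    (h₅ : ⟪u₀ + h • ((-3 : ℝ) • k₁ + (2 : ℝ) • k₂ + k₃ + k₄), k₅⟫ ≤ 0)
    (hp : ‖(2 : ℝ) • (k₂ - k₁) - (k₃ - k₁)‖ ≤ 3 / 2 * ‖k₃ - k₁‖)
    (hr : ‖k₄ - k₁‖ ≤ 1 / 10 * ‖k₃ - k₁‖)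
    (he : ‖k₅ - k₃‖ ≤ 1 / 10 * ‖k₃ - k₁‖) :
    ‖u₀ + h • ((2 / 3 : ℝ) • k₂ + (1 / 6 : ℝ) • k₄ + (1 / 6 : ℝ) • k₅)‖ ≤ ‖u₀‖ := by
  have hQ := mul_nonpos_of_nonneg_of_nonpos (sq_nonneg h) (energy_quadratic_form_nonpos hp hr he)
  have g₂ := mul_nonpos_of_nonneg_of_nonpos hh h₂
  have g₄ := mul_nonpos_of_nonneg_of_nonpos hh h₄
  have g₅ := mul_nonpos_of_nonneg_of_nonpos hh h₅
  refine le_of_sq_le_sq ?_ (norm_nonneg _)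
  rw [← real_inner_self_eq_norm_sq, ← real_inner_self_eq_norm_sq]
  simp only [inner_add_left, inner_add_right, inner_sub_left, inner_sub_right,
    real_inner_smul_left, real_inner_smul_right] at hQ g₂ g₄ g₅ ⊢
  simp only [real_inner_comm k₂ u₀,
    real_inner_comm k₄ u₀, real_inner_comm k₅ u₀, real_inner_comm k₂ k₁, real_inner_comm k₃ k₁,
    real_inner_comm k₄ k₁, real_inner_comm k₅ k₁, real_inner_comm k₃ k₂, real_inner_comm k₄ k₂,
    real_inner_comm k₅ k₂, real_inner_comm k₄ k₃, real_inner_comm k₅ k₃,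
    real_inner_comm k₅ k₄] at hQ g₂ g₄ g₅ ⊢
  linarith

/-- Corollary 4.13: the explicit 5-stage, third order method with nodes `(0,1/2,1,0,1)`,
weights `(0,2/3,0,1/6,1/6)` and rows `(0,0,0,0,0), (1/2,0,0,0,0), (1,0,0,0,0),
(1,0,-1,0,0), (-3,2,1,1,0)` is conditionally energy stable for autonomous ODEs
`u' = f(u)` with analytic and semibounded right-hand side in a real Hilbert space. -/
theorem conditional_energy_stability_five_stage_method
    {H : Type*} [NormedAddCommGroup H] [InnerProductSpace ℝ H] [CompleteSpace H]
    (A : Fin 5 → Fin 5 → ℝ) (b : Fin 5 → ℝ)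
    (hA : A = !![0, 0, 0, 0, 0; 1 / 2, 0, 0, 0, 0; 1, 0, 0, 0, 0;
                 1, 0, -1, 0, 0; -3, 2, 1, 1, 0])
    (hb : b = ![0, 2 / 3, 0, 1 / 6, 1 / 6])
    (f : H → H) (hf : ∀ x : H, AnalyticAt ℝ f x)
    (hsemi : ∀ u : H, ⟪u, f u⟫ ≤ 0)
    (u₀ : H) :
    ∃ Δtmax > (0 : ℝ), ∀ Δt : ℝ, 0 < Δt → Δt ≤ Δtmax →
      ∀ u : Fin 5 → H,
        (∀ i, u i = u₀ + Δt • ∑ j, A i j • f (u j)) →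
        ‖u₀ + Δt • ∑ i, b i • f (u i)‖ ≤ ‖u₀‖ := by
  have hfc : Continuous f := continuous_iff_continuousAt.mpr fun x => (hf x).continuousAt
  obtain ⟨L, s, hs, hL⟩ := (hf u₀).contDiffAt (n := 1).exists_lipschitzOnWith
  have hline : AnalyticAt ℝ (fun t : ℝ => f (u₀ + t • f u₀)) 0 :=
    (hf _).fun_comp (by fun_prop)
  let k₂ : ℝ → H := fun t => f (u₀ + (t / 2) • f u₀)
  let u₃ : ℝ → H := fun t => u₀ + t • f u₀
  let u₄ : ℝ → H := fun t => u₀ + t • (f u₀ - f (u₃ t))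
  let u₅ : ℝ → H := fun t =>
    u₀ + t • ((-3 : ℝ) • f u₀ + (2 : ℝ) • k₂ t + f (u₃ t) + f (u₄ t))
  have mem_near : ∀ v : ℝ → H, Continuous v → v 0 = u₀ → ∀ᶠ t in 𝓝 (0 : ℝ), v t ∈ s :=
    fun v hv hv0 => hv.continuousAt (by rwa [hv0])
  have hLt : ∀ᶠ t in 𝓝 (0 : ℝ), 40 * (L : ℝ) * t < 1 :=
    (show Continuous fun t : ℝ => 40 * (L : ℝ) * t by fun_prop).continuousAt.eventually_lt
      continuousAt_const (by simp)
  have hev := hline.eventually_norm_two_smul_half_sub_le.and <|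
    (mem_near u₃ (by fun_prop) (by simp [u₃])).and <|
    (mem_near u₄ (by fun_prop) (by simp [u₄])).and <|
    (mem_near u₅ (by fun_prop) (by simp [u₅])).and hLt
  obtain ⟨ε, hε, hball⟩ := Metric.eventually_nhds_iff.mp hev
  refine ⟨ε / 2, by positivity, fun h hpos hle u hu => ?_⟩
  obtain ⟨hp, m₃, m₄, m₅, hsmall⟩ :=
    hball (show dist h (0 : ℝ) < ε by rw [Real.dist_0_eq_abs, abs_of_pos hpos]; linarith)
  have e₁ : u 0 = u₀ := by rw [hu 0]; simp [hA, Fin.sum_univ_five]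
  have e₂ : u 1 = u₀ + h • (1 / 2 : ℝ) • f u₀ := by
    rw [hu 1]; simp [hA, Fin.sum_univ_five, e₁]
  have e₃ : u 2 = u₃ h := by rw [hu 2]; simp [hA, Fin.sum_univ_five, e₁, u₃]
  have e₄ : u 3 = u₀ + h • (f u₀ - f (u 2)) := by
    rw [hu 3]; simp [hA, Fin.sum_univ_five, e₁, sub_eq_add_neg]
  have e₅ : u 4 = u₀ + h • ((-3 : ℝ) • f u₀ + (2 : ℝ) • f (u 1) + f (u 2) + f (u 3)) := by
    rw [hu 4]; simp [hA, Fin.sum_univ_five, e₁]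
  have hk₂ : k₂ h = f (u 1) := by simp only [k₂, e₂, smul_smul]; congr 3; ring
  have e₄' : u₄ h = u 3 := by simp only [u₄, e₄, e₃]
  have e₅' : u₅ h = u 4 := by simp only [u₅, e₅, e₃, e₄', hk₂]
  rw [← e₃] at m₃
  rw [e₄'] at m₄
  rw [e₅'] at m₅
  have hp' : ‖(2 : ℝ) • (f (u 1) - f u₀) - (f (u 2) - f u₀)‖ ≤ 3 / 2 * ‖f (u 2) - f u₀‖ := by
    rw [← hk₂, e₃]
    simpa only [zero_smul, add_zero] using hp
  have hr : ‖f (u 3) - f u₀‖ ≤ L * h * ‖f (u 2) - f u₀‖ := by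
    refine (hL.norm_sub_le m₄ (mem_of_mem_nhds hs)).trans_eq ?_
    rw [e₄, add_sub_cancel_left, norm_smul, Real.norm_of_nonneg hpos.le, norm_sub_rev, mul_assoc]
  have hr' : ‖f (u 3) - f u₀‖ ≤ 1 / 10 * ‖f (u 2) - f u₀‖ :=
    hr.trans (by gcongr; linarith [mul_nonneg L.coe_nonneg hpos.le])
  have he : ‖f (u 4) - f (u 2)‖ ≤ 1 / 10 * ‖f (u 2) - f u₀‖ := by
    have hdiff : u 4 - u 2 = h • (((2 : ℝ) • (f (u 1) - f u₀) - (f (u 2) - f u₀))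
        + (2 : ℝ) • (f (u 2) - f u₀) + (f (u 3) - f u₀)) := by
      rw [e₅, e₃]; simp only [u₃]; module
    have hsum : ‖((2 : ℝ) • (f (u 1) - f u₀) - (f (u 2) - f u₀))
        + (2 : ℝ) • (f (u 2) - f u₀) + (f (u 3) - f u₀)‖ ≤ 4 * ‖f (u 2) - f u₀‖ := by
      refine norm_add₃_le.trans ?_
      rw [norm_smul, Real.norm_ofNat]
      linarith [norm_nonneg (f (u 2) - f u₀)]
    calc ‖f (u 4) - f (u 2)‖ ≤ L * ‖u 4 - u 2‖ := hL.norm_sub_le m₅ m₃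
      _ ≤ L * (h * (4 * ‖f (u 2) - f u₀‖)) := by
        rw [hdiff, norm_smul, Real.norm_of_nonneg hpos.le]; gcongr
      _ = 4 * L * h * ‖f (u 2) - f u₀‖ := by ring
      _ ≤ 1 / 10 * ‖f (u 2) - f u₀‖ := by gcongr; linarith
  have key := norm_step_le_of_slope_bounds hpos.le
    ((congrArg (⟪·, f (u 1)⟫) e₂).symm.trans_le (hsemi _))
    ((congrArg (⟪·, f (u 3)⟫) e₄).symm.trans_le (hsemi _))
    ((congrArg (⟪·, f (u 4)⟫) e₅).symm.trans_le (hsemi _)) hp' hr' he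
  simpa [hb, Fin.sum_univ_five] using key
end

section
/- Let R(z) = Σ_{j=0}^d α_j z^j be a polynomial with real coefficients satisfying α₀ = 1 and α₁ = 1 (the stability polynomial of a consistent explicit Runge–Kutta method), let m ≥ 1, and let L ∈ M_m(ℂ) with L ≠ 0. Then there exist u₀ ∈ ℂ^m and Δt_* ≥ 0 such that for every Δt > Δt_*, the sequence uⁿ = (R(Δt L))ⁿ u₀ satisfies ‖uⁿ‖ → ∞ as n → ∞. -/
open Filter

open Polynomial in
/-- A complex matrix whose only possible eigenvalue is zero is nilpotent. -/
theorem isNilpotent_of_forall_eigenvalue_eq_zero {ι : Type*} [Fintype ι] [DecidableEq ι]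
    (L : Matrix ι ι ℂ) (h : ∀ (c : ℂ) (v : ι → ℂ), v ≠ 0 → L.mulVec v = c • v → c = 0) :
    IsNilpotent L := by
  have hroots : ∀ c ∈ L.charpoly.roots, c = 0 := by
    intro c hc
    have hdet : (Matrix.scalar ι c - L).det = 0 := by
      rw [← Matrix.eval_charpoly]
      exact isRoot_of_mem_roots hc
    obtain ⟨v, hv, hLv⟩ := Matrix.exists_mulVec_eq_zero_iff.mpr hdet
    refine h c v hv ?_
    rw [Matrix.sub_mulVec, sub_eq_zero] at hLv
    rw [← hLv]
    ext i
    simp [Matrix.scalar_apply, Matrix.mulVec_diagonal]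
  have hprod := (IsAlgClosed.splits L.charpoly).eq_prod_roots_of_monic L.charpoly_monic
  rw [Multiset.eq_replicate_of_mem hroots, Multiset.map_replicate, Multiset.prod_replicate,
    C_0, sub_zero] at hprod
  refine ⟨L.charpoly.roots.card, ?_⟩
  have hCH := L.aeval_self_charpoly
  rw [hprod, map_pow, aeval_X] at hCH
  exact hCH

/-- A nonzero nilpotent matrix has a generalized eigenvector of rank two. -/
theorem exists_mulVec_ne_zero_of_isNilpotent {ι : Type*} [Fintype ι] [DecidableEq ι]
    {L : Matrix ι ι ℂ} (hnil : IsNilpotent L) (hL : L ≠ 0) :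
    ∃ v : ι → ℂ, L.mulVec v ≠ 0 ∧ (L ^ 2).mulVec v = 0 := by
  obtain ⟨k, hk, hmin⟩ : ∃ k, L ^ (k + 2) = 0 ∧ L ^ (k + 1) ≠ 0 := by
    classical
    have hpos : 2 ≤ Nat.find hnil := by
      by_contra! hlt
      exact hL (by simpa using pow_eq_zero_of_le (Nat.le_of_lt_succ hlt) (Nat.find_spec hnil))
    refine ⟨Nat.find hnil - 2, ?_, Nat.find_min hnil (by omega)⟩
    rw [Nat.sub_add_cancel hpos]
    exact Nat.find_spec hnil
  obtain ⟨w, hw⟩ : ∃ w, (L ^ (k + 1)).mulVec w ≠ 0 := by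
    by_contra! hzero
    exact hmin (Matrix.mulVec_injective (funext fun w => by simp [hzero w]))
  refine ⟨(L ^ k).mulVec w, ?_, ?_⟩
  · rwa [Matrix.mulVec_mulVec, ← pow_succ']
  · rw [Matrix.mulVec_mulVec, ← pow_add, add_comm, hk, Matrix.zero_mulVec]

theorem pow_mulVec_of_mulVec_eq_smul {ι : Type*} [Fintype ι] [DecidableEq ι]
    {A : Matrix ι ι ℂ} {c : ℂ} {v : ι → ℂ} (h : A.mulVec v = c • v) (n : ℕ) :
    (A ^ n).mulVec v = c ^ n • v := by
  induction n with
  | zero => simp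
  | succ n ih =>
    rw [pow_succ, ← Matrix.mulVec_mulVec, h, Matrix.mulVec_smul, ih, smul_smul, pow_succ']

theorem pow_mulVec_of_mulVec_eq_add {ι : Type*} [Fintype ι] [DecidableEq ι]
    {A : Matrix ι ι ℂ} {v w : ι → ℂ} (hv : A.mulVec v = v + w) (hw : A.mulVec w = w) (n : ℕ) :
    (A ^ n).mulVec v = v + (n : ℂ) • w := by
  induction n with
  | zero => simp
  | succ n ih =>
    rw [pow_succ', ← Matrix.mulVec_mulVec, ih, Matrix.mulVec_add, Matrix.mulVec_smul, hv, hw]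
    push_cast
    module

open Polynomial in
/-- A polynomial with nonzero linear coefficient has modulus above one at large real arguments. -/
theorem eventually_one_lt_norm_eval_ofReal {p : ℂ[X]} (hp : p.coeff 1 ≠ 0) :
    ∀ᶠ t : ℝ in atTop, 1 < ‖p.eval (t : ℂ)‖ := by
  have hdeg : 0 < p.degree :=
    lt_of_lt_of_le (by norm_num) (le_degree_of_ne_zero hp)
  refine (p.tendsto_norm_atTop hdeg ?_).eventually_gt_atTop 1
  simpa using tendsto_abs_atTop_atTop

/-- Theorem 5.1: for every consistent stability polynomial `R(z) = ∑_{j=0}^d αⱼ zʲ`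
(with `α₀ = α₁ = 1`) and every nonzero matrix `L ∈ M_m(ℂ)`, there exist an initial value
`u₀` and a threshold `Δt_*` such that the iterates `uⁿ = R(Δt L)ⁿ u₀` blow up as
`n → ∞` for every `Δt > Δt_*`. -/
theorem linear_blowup_explicit_runge_kutta
    (d : ℕ) (hd : 1 ≤ d) (α : ℕ → ℝ) (hα₀ : α 0 = 1) (hα₁ : α 1 = 1)
    (m : ℕ) (hm : 1 ≤ m) (L : Matrix (Fin m) (Fin m) ℂ) (hL : L ≠ 0) :
    ∃ (u₀ : Fin m → ℂ) (Δtstar : ℝ), 0 ≤ Δtstar ∧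
      ∀ Δt : ℝ, Δtstar < Δt →
        Tendsto
          (fun n : ℕ =>
            ‖(((∑ j ∈ Finset.range (d + 1), ((α j : ℂ) * (Δt : ℂ) ^ j) • L ^ j)) ^ n).mulVec u₀‖)
          atTop atTop := by
  by_cases h : ∀ (c : ℂ) (v : Fin m → ℂ), v ≠ 0 → L.mulVec v = c • v → c = 0
  · obtain ⟨v, hv, hv2⟩ := exists_mulVec_ne_zero_of_isNilpotent
      (isNilpotent_of_forall_eigenvalue_eq_zero L h) hL
    have hvpow : ∀ j, (L ^ (j + 2)).mulVec v = 0 := fun j => by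
      rw [pow_add, ← Matrix.mulVec_mulVec, hv2, Matrix.mulVec_zero]
    have hLpow : ∀ j, (L ^ (j + 1)).mulVec (L.mulVec v) = 0 := fun j => by
      rw [Matrix.mulVec_mulVec, ← pow_succ, hvpow]
    obtain ⟨e, rfl⟩ := Nat.exists_eq_add_of_le' hd
    refine ⟨v, 0, le_rfl, fun Δt hΔt => ?_⟩
    set w := (Δt : ℂ) • L.mulVec v with hw
    have hw0 : w ≠ 0 := smul_ne_zero (by exact_mod_cast hΔt.ne') hv
    have hstep := pow_mulVec_of_mulVec_eq_add
      (A := ∑ j ∈ Finset.range (e + 1 + 1), ((α j : ℂ) * (Δt : ℂ) ^ j) • L ^ j) (v := v) (w := w)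
      (by
        rw [Matrix.sum_mulVec, Finset.sum_range_succ', Finset.sum_range_succ']
        simp [Matrix.smul_mulVec, add_assoc, hvpow, hα₀, hα₁, hw, add_comm v])
      (by
        rw [Matrix.sum_mulVec, Finset.sum_range_succ']
        simp [-Matrix.mulVec_mulVec, Matrix.smul_mulVec, Matrix.mulVec_smul, hLpow, hα₀, hw])
    simp_rw [hstep]
    have hlin : Tendsto (fun n : ℕ => (n : ℝ) * ‖w‖ - ‖v‖) atTop atTop :=
      tendsto_atTop_add_const_right _ _
        (tendsto_natCast_atTop_atTop.atTop_mul_const (norm_pos_iff.mpr hw0))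
    refine tendsto_atTop_mono (fun n => ?_) hlin
    have := norm_sub_norm_le ((n : ℂ) • w) (-v)
    rwa [norm_neg, sub_neg_eq_add, add_comm _ v, norm_smul, Complex.norm_natCast] at this
  · push Not at h
    obtain ⟨c, v, hv, hLv, hc⟩ := h
    let p : Polynomial ℂ :=
      ∑ j ∈ Finset.range (d + 1), Polynomial.monomial j ((α j : ℂ) * c ^ j)
    have hp : p.coeff 1 ≠ 0 := by
      simp [p, Polynomial.finsetSum_coeff, Polynomial.coeff_monomial, hα₁, hc,
        Nat.ne_of_gt hd]
    obtain ⟨T, hT⟩ := eventually_atTop.mp (eventually_one_lt_norm_eval_ofReal hp)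
    refine ⟨v, max T 0, le_max_right _ _, fun Δt hΔt => ?_⟩
    have hstep := pow_mulVec_of_mulVec_eq_smul
      (A := ∑ j ∈ Finset.range (d + 1), ((α j : ℂ) * (Δt : ℂ) ^ j) • L ^ j)
      (c := p.eval (Δt : ℂ)) (v := v) (by
        simp only [Matrix.sum_mulVec, Matrix.smul_mulVec, pow_mulVec_of_mulVec_eq_smul hLv, p,
          Polynomial.eval_finsetSum, Polynomial.eval_monomial, Finset.sum_smul, smul_smul,
          mul_right_comm])
    simp_rw [hstep, norm_smul, norm_pow]
    exact (tendsto_pow_atTop_atTop_of_one_lt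
      (hT Δt ((le_max_left _ _).trans hΔt.le))).atTop_mul_const (norm_pos_iff.mpr hv)
end

section
/- Let f : ℝ² \ {0} → ℝ² be given by f(u) = (−u₂, u₁)/(u₁² + u₂²), which satisfies ⟨u, f(u)⟩ = 0 for all u ≠ 0. For every u₀ ∈ ℝ² with u₀ ≠ 0 and every Δt ∈ ℝ, the intermediate value y₂ = u₀ + (Δt/2) f(u₀) of the explicit midpoint Runge–Kutta method is nonzero, and the update u₊ = u₀ + Δt f(y₂) satisfies ‖u₊‖ = ‖u₀‖. Consequently, for every step size Δt and every nonzero initial value, all iterates of the explicit midpoint method applied to u' = f(u) are defined and have norm equal to ‖u₀‖, so the numerical solution remains bounded as n → ∞. -/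
open scoped RealInnerProductSpace

/-- A nonzero vector of the Euclidean plane has positive sum of squared coordinates. -/
theorem EuclideanSpace.sq_add_sq_pos_of_ne_zero {u : EuclideanSpace ℝ (Fin 2)} (hu : u ≠ 0) :
    0 < (u 0) ^ 2 + (u 1) ^ 2 := by
  have h := pow_pos (norm_pos_iff.mpr hu) 2
  rwa [EuclideanSpace.real_norm_sq_eq, Fin.sum_univ_two] at h

/-- With `r = a² + b²`, the midpoint stage started at `(a, b)` has squared norm `r + h² / r`. -/
theorem midpoint_stage_sq_add_sq {a b : ℝ} (hr : 0 < a ^ 2 + b ^ 2) (h : ℝ) :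
    (a + h * ((a ^ 2 + b ^ 2)⁻¹ * -b)) ^ 2 + (b + h * ((a ^ 2 + b ^ 2)⁻¹ * a)) ^ 2 =
      (a ^ 2 + b ^ 2) + h ^ 2 * (a ^ 2 + b ^ 2)⁻¹ := by
  field_simp
  ring

/-- The update along the rotated stage `(-q, p)`, scaled by the inverse of its squared norm,
preserves the squared norm of `(a, b)`. -/
theorem midpoint_update_sq_add_sq {a b p q h : ℝ} (hr : 0 < a ^ 2 + b ^ 2)
    (hp : p = a + h / 2 * ((a ^ 2 + b ^ 2)⁻¹ * -b))
    (hq : q = b + h / 2 * ((a ^ 2 + b ^ 2)⁻¹ * a)) (hs : 0 < p ^ 2 + q ^ 2) :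
    (a + h * ((p ^ 2 + q ^ 2)⁻¹ * -q)) ^ 2 + (b + h * ((p ^ 2 + q ^ 2)⁻¹ * p)) ^ 2 =
      a ^ 2 + b ^ 2 := by
  have hcross : b * p - a * q = -(h / 2) := by
    rw [hp, hq]
    field_simp
    ring
  have hinv : (p ^ 2 + q ^ 2)⁻¹ * (p ^ 2 + q ^ 2) = 1 := inv_mul_cancel₀ hs.ne'
  linear_combination 2 * h * (p ^ 2 + q ^ 2)⁻¹ * hcross + h ^ 2 * (p ^ 2 + q ^ 2)⁻¹ * hinv

/-- Theorem 5.2: the explicit midpoint Runge--Kutta method applied to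
`u' = f(u)` with `f(u) = (-u₂, u₁)/(u₁² + u₂²)` conserves the Euclidean norm exactly:
the stage `y₂` is always nonzero, one step preserves the norm, and hence every iterate
is defined, nonzero, and has norm `‖u₀‖`, so the numerical solution remains bounded. -/
theorem explicit_midpoint_unconditionally_stable
    (f : EuclideanSpace ℝ (Fin 2) → EuclideanSpace ℝ (Fin 2))
    (hf : ∀ u : EuclideanSpace ℝ (Fin 2),
      f u = ((u 0) ^ 2 + (u 1) ^ 2)⁻¹ • ![-(u 1), u 0]) :
    (∀ u : EuclideanSpace ℝ (Fin 2), u ≠ 0 → ⟪u, f u⟫ = 0) ∧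
    ∀ u₀ : EuclideanSpace ℝ (Fin 2), u₀ ≠ 0 → ∀ Δt : ℝ,
      (u₀ + (Δt / 2) • f u₀ ≠ 0) ∧
      ‖u₀ + Δt • f (u₀ + (Δt / 2) • f u₀)‖ = ‖u₀‖ ∧
      ∀ u : ℕ → EuclideanSpace ℝ (Fin 2),
        u 0 = u₀ →
        (∀ n, u (n + 1) = u n + Δt • f (u n + (Δt / 2) • f (u n))) →
        ∀ n, u n ≠ 0 ∧ ‖u n‖ = ‖u₀‖ := by
  have hf0 (u : EuclideanSpace ℝ (Fin 2)) :
      f u 0 = ((u 0) ^ 2 + (u 1) ^ 2)⁻¹ * -(u 1) := by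
    simp [hf u]
  have hf1 (u : EuclideanSpace ℝ (Fin 2)) :
      f u 1 = ((u 0) ^ 2 + (u 1) ^ 2)⁻¹ * u 0 := by
    simp [hf u]
  have hstage (u : EuclideanSpace ℝ (Fin 2)) (hu : u ≠ 0) (Δt : ℝ) :
      u + (Δt / 2) • f u ≠ 0 := by
    intro h
    have hr := EuclideanSpace.sq_add_sq_pos_of_ne_zero hu
    have h0 : u 0 + Δt / 2 * f u 0 = 0 := by simpa using congrArg (fun v ↦ v 0) h
    have h1 : u 1 + Δt / 2 * f u 1 = 0 := by simpa using congrArg (fun v ↦ v 1) h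
    have hsq := midpoint_stage_sq_add_sq hr (Δt / 2)
    rw [← hf0, ← hf1, h0, h1] at hsq
    have hpos : 0 < (u 0 ^ 2 + u 1 ^ 2) + (Δt / 2) ^ 2 * (u 0 ^ 2 + u 1 ^ 2)⁻¹ := by positivity
    linarith
  have hstep (u : EuclideanSpace ℝ (Fin 2)) (hu : u ≠ 0) (Δt : ℝ) :
      ‖u + Δt • f (u + (Δt / 2) • f u)‖ = ‖u‖ := by
    have hupdate := midpoint_update_sq_add_sq (h := Δt)
      (p := (u + (Δt / 2) • f u) 0) (q := (u + (Δt / 2) • f u) 1)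
      (EuclideanSpace.sq_add_sq_pos_of_ne_zero hu)
      (by rw [← hf0]; rfl) (by rw [← hf1]; rfl)
      (EuclideanSpace.sq_add_sq_pos_of_ne_zero (hstage u hu Δt))
    rw [← hf0, ← hf1] at hupdate
    rw [← sq_eq_sq₀ (norm_nonneg _) (norm_nonneg _), EuclideanSpace.real_norm_sq_eq,
      EuclideanSpace.real_norm_sq_eq, Fin.sum_univ_two, Fin.sum_univ_two]
    exact hupdate
  refine ⟨fun u _ ↦ ?_, fun u₀ hu₀ Δt ↦ ⟨hstage u₀ hu₀ Δt, hstep u₀ hu₀ Δt, ?_⟩⟩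
  · rw [PiLp.inner_apply, Fin.sum_univ_two, hf0, hf1]
    simp only [RCLike.inner_apply, conj_trivial]
    ring
  · intro u hzero hsucc n
    induction n with
    | zero => exact ⟨hzero ▸ hu₀, by rw [hzero]⟩
    | succ n ih =>
      have hnorm : ‖u (n + 1)‖ = ‖u₀‖ := by rw [hsucc, hstep _ ih.1, ih.2]
      exact ⟨norm_pos_iff.mp (hnorm ▸ norm_pos_iff.mpr hu₀), hnorm⟩
end

section
/- Let f : ℝ² \ {0} → ℝ² be given by f(u) = (−u₂, u₁)/(u₁² + u₂²). Let r₀ > 0, θ₀ ∈ ℝ, Δt > 0, and u₀ = r₀ (cos θ₀, sin θ₀). Then the iterates uⁿ of the explicit midpoint Runge–Kutta method with step size Δt applied to u' = f(u) are given by uⁿ = r₀ (cos(θ₀ + n θ_h), sin(θ₀ + n θ_h)) for all n ∈ ℕ, where θ_h ∈ (0, π) is determined by cos θ_h = (r₀² − Δt²/(4r₀²)) / (r₀² + Δt²/(4r₀²)) and sin θ_h = Δt / (r₀² + Δt²/(4r₀²)); equivalently θ_h = arccos((r₀² − Δt²/(4r₀²)) / (r₀² + Δt²/(4r₀²))). 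-/
/-- One explicit midpoint step for `u' = (-u₂, u₁)/(u₁² + u₂²)` from a point of the circle of
radius `r`, in coordinates: a linear map commuting with rotations. -/
theorem explicit_midpoint_step_coords
    (f : EuclideanSpace ℝ (Fin 2) → EuclideanSpace ℝ (Fin 2))
    (hf : ∀ u : EuclideanSpace ℝ (Fin 2),
      f u = ((u 0) ^ 2 + (u 1) ^ 2)⁻¹ • ![-(u 1), u 0])
    {r Δt : ℝ} (hr : 0 < r) (u : EuclideanSpace ℝ (Fin 2))
    (hu : u 0 ^ 2 + u 1 ^ 2 = r ^ 2) :
    (u + Δt • f (u + (Δt / 2) • f u)) 0 =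
        (r ^ 2 - Δt ^ 2 / (4 * r ^ 2)) / (r ^ 2 + Δt ^ 2 / (4 * r ^ 2)) * u 0 -
          Δt / (r ^ 2 + Δt ^ 2 / (4 * r ^ 2)) * u 1 ∧
      (u + Δt • f (u + (Δt / 2) • f u)) 1 =
        (r ^ 2 - Δt ^ 2 / (4 * r ^ 2)) / (r ^ 2 + Δt ^ 2 / (4 * r ^ 2)) * u 1 +
          Δt / (r ^ 2 + Δt ^ 2 / (4 * r ^ 2)) * u 0 := by
  have hf0 : ∀ v, f v 0 = -((v 0 ^ 2 + v 1 ^ 2)⁻¹ * v 1) := fun v => by simp [hf]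
  have hf1 : ∀ v, f v 1 = (v 0 ^ 2 + v 1 ^ 2)⁻¹ * v 0 := fun v => by simp [hf]
  have hD : r ^ 2 + Δt ^ 2 / (4 * r ^ 2) ≠ 0 := by positivity
  have hstage : (u 0 + Δt / 2 * -((r ^ 2)⁻¹ * u 1)) ^ 2 + (u 1 + Δt / 2 * ((r ^ 2)⁻¹ * u 0)) ^ 2 =
      r ^ 2 + Δt ^ 2 / (4 * r ^ 2) := by
    have h : (u 0 + Δt / 2 * -((r ^ 2)⁻¹ * u 1)) ^ 2 + (u 1 + Δt / 2 * ((r ^ 2)⁻¹ * u 0)) ^ 2 =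
        (u 0 ^ 2 + u 1 ^ 2) * (1 + (Δt / 2 * (r ^ 2)⁻¹) ^ 2) := by ring
    rw [h, hu]
    field_simp
    ring
  have hsplit : (r ^ 2 - Δt ^ 2 / (4 * r ^ 2)) / (r ^ 2 + Δt ^ 2 / (4 * r ^ 2)) =
      1 - (r ^ 2 + Δt ^ 2 / (4 * r ^ 2))⁻¹ * (Δt ^ 2 / 2 * (r ^ 2)⁻¹) := by
    rw [div_eq_iff hD, sub_mul, mul_right_comm, inv_mul_cancel₀ hD]
    field_simp
    ring
  simp only [PiLp.add_apply, PiLp.smul_apply, smul_eq_mul, hf0, hf1, hu, hstage]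
  rw [hsplit]
  constructor <;> ring


/-- The closed-form numerical solution of the explicit midpoint method applied to
`u' = (-u₂, u₁)/(u₁² + u₂²)`: with `u₀ = r₀(cos θ₀, sin θ₀)` the iterates are
`uⁿ = r₀(cos(θ₀ + n θ_h), sin(θ₀ + n θ_h))` where
`θ_h = arccos((r₀² - Δt²/(4r₀²))/(r₀² + Δt²/(4r₀²))) ∈ (0, π)`. -/
theorem explicit_midpoint_closed_form_solution
    (f : EuclideanSpace ℝ (Fin 2) → EuclideanSpace ℝ (Fin 2))
    (hf : ∀ u : EuclideanSpace ℝ (Fin 2),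
      f u = ((u 0) ^ 2 + (u 1) ^ 2)⁻¹ • ![-(u 1), u 0])
    (r₀ θ₀ Δt : ℝ) (hr₀ : 0 < r₀) (hΔt : 0 < Δt)
    (u₀ : EuclideanSpace ℝ (Fin 2))
    (hu₀ : u₀ = r₀ • ![Real.cos θ₀, Real.sin θ₀])
    (θh : ℝ)
    (hθh : θh = Real.arccos ((r₀ ^ 2 - Δt ^ 2 / (4 * r₀ ^ 2))
        / (r₀ ^ 2 + Δt ^ 2 / (4 * r₀ ^ 2)))) :
    θh ∈ Set.Ioo 0 Real.pi ∧
    Real.cos θh = (r₀ ^ 2 - Δt ^ 2 / (4 * r₀ ^ 2)) / (r₀ ^ 2 + Δt ^ 2 / (4 * r₀ ^ 2)) ∧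
    Real.sin θh = Δt / (r₀ ^ 2 + Δt ^ 2 / (4 * r₀ ^ 2)) ∧
    ∀ u : ℕ → EuclideanSpace ℝ (Fin 2),
      u 0 = u₀ →
      (∀ n, u (n + 1) = u n + Δt • f (u n + (Δt / 2) • f (u n))) →
      ∀ n : ℕ, u n = r₀ • ![Real.cos (θ₀ + n * θh), Real.sin (θ₀ + n * θh)] := by
  have hD : 0 < r₀ ^ 2 + Δt ^ 2 / (4 * r₀ ^ 2) := by positivity
  have hq : 0 < Δt ^ 2 / (4 * r₀ ^ 2) := by positivity
  have hlo : -1 < (r₀ ^ 2 - Δt ^ 2 / (4 * r₀ ^ 2)) / (r₀ ^ 2 + Δt ^ 2 / (4 * r₀ ^ 2)) := by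
    rw [lt_div_iff₀ hD]
    nlinarith [sq_pos_of_pos hr₀]
  have hhi : (r₀ ^ 2 - Δt ^ 2 / (4 * r₀ ^ 2)) / (r₀ ^ 2 + Δt ^ 2 / (4 * r₀ ^ 2)) < 1 := by
    rw [div_lt_one hD]
    linarith
  have hcos : Real.cos θh =
      (r₀ ^ 2 - Δt ^ 2 / (4 * r₀ ^ 2)) / (r₀ ^ 2 + Δt ^ 2 / (4 * r₀ ^ 2)) := by
    rw [hθh, Real.cos_arccos hlo.le hhi.le]
  have hsin : Real.sin θh = Δt / (r₀ ^ 2 + Δt ^ 2 / (4 * r₀ ^ 2)) := by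
    rw [hθh, Real.sin_arccos, Real.sqrt_eq_iff_mul_self_eq_of_pos (by positivity)]
    field_simp
    ring
  refine ⟨⟨?_, ?_⟩, hcos, hsin, ?_⟩
  · rw [hθh]
    exact Real.arccos_pos.2 hhi
  · rw [hθh]
    exact (Real.arccos_lt_pi).2 hlo
  · intro u hu0 hstep
    have key : ∀ n : ℕ, u n 0 = r₀ * Real.cos (θ₀ + n * θh) ∧
        u n 1 = r₀ * Real.sin (θ₀ + n * θh) := by
      intro n
      induction n with
      | zero => simp [hu0, hu₀]
      | succ k ih =>
        obtain ⟨ih0, ih1⟩ := ih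
        have hnorm : u k 0 ^ 2 + u k 1 ^ 2 = r₀ ^ 2 := by
          rw [ih0, ih1]
          linear_combination r₀ ^ 2 * Real.cos_sq_add_sin_sq (θ₀ + k * θh)
        have hangle : θ₀ + ((k + 1 : ℕ) : ℝ) * θh = (θ₀ + k * θh) + θh := by
          push_cast
          ring
        obtain ⟨h0, h1⟩ := explicit_midpoint_step_coords f hf (Δt := Δt) hr₀ (u k) hnorm
        rw [hstep k, h0, h1, hangle, Real.cos_add _ θh, Real.sin_add _ θh, ← hcos, ← hsin, ih0, ih1]
        constructor <;> ring
    intro n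
    ext i
    fin_cases i
    · simpa using (key n).1
    · simpa using (key n).2
end
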